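/- Let H be a separable infinite-dimensional real Hilbert space and endow O₊(B) with the topology of pointwise convergence (the coarsest topology for which g ↦ g(x) is continuous for every x ∈ ℝ × H). Then every irreducible group homomorphism ρ : O₊(B) → O₊(B) — i.e. one for which the only closed linear subspaces N ⊆ ℝ × H with ρ(g)(N) ⊆ N for all g are {0} and ℝ × H — is continuous. -/

import Mathlib

open scoped RealInnerProductSpace

variable (H : Type*) [NormedAddCommGroup H] [InnerProductSpace ℝ H]

/-- The Minkowski bilinear form on `ℝ × H`. -/
noncomputable def minkB (v w : ℝ × H) : ℝ := v.1 * w.1 - ⟪v.2, w.2⟫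

/-- The hyperboloid model of hyperbolic space inside `ℝ × H`. -/
noncomputable def Hyp : Set (ℝ × H) := {v | minkB H v v = 1 ∧ 0 < v.1}

/-- Inverse hyperbolic cosine. -/
noncomputable def arcosh (x : ℝ) : ℝ := Real.log (x + Real.sqrt (x ^ 2 - 1))

/-- The hyperbolic distance on the hyperboloid. -/
noncomputable def hypDist (x y : ℝ × H) : ℝ := arcosh (minkB H x y)

/-- A subset of the hyperboloid is hyperbolically total if its closed linear span
is all of `ℝ × H`. -/
def HypTotal (S : Set (ℝ × H)) : Prop :=
  (Submodule.span ℝ S).topologicalClosure = ⊤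

/-- A kernel of hyperbolic type. -/
def IsHypKernel {X : Type*} (β : X → X → ℝ) : Prop :=
  (∀ x y, β x y = β y x) ∧ (∀ x y, 0 ≤ β x y) ∧ (∀ x, β x x = 1) ∧
    ∀ (n : ℕ) (x₀ : X) (x : Fin n → X) (c : Fin n → ℝ),
      ∑ i, ∑ j, c i * c j * β (x i) (x j) ≤ (∑ k, c k * β (x k) x₀) ^ 2

/-- A kernel of conditionally negative type. -/
def IsCNDKernel {X : Type*} (ψ : X → X → ℝ) : Prop :=
  (∀ x y, ψ x y = ψ y x) ∧ (∀ x, ψ x x = 0) ∧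
    ∀ (n : ℕ) (x : Fin n → X) (c : Fin n → ℝ), (∑ i, c i = 0) →
      ∑ i, ∑ j, c i * c j * ψ (x i) (x j) ≤ 0

/-- The group `O₊(B)` of continuous linear automorphisms of `ℝ × H` preserving the
Minkowski form and the upper hyperboloid sheet. -/
noncomputable def Oplus : Subgroup ((ℝ × H) ≃L[ℝ] (ℝ × H)) where
  carrier := {g | (∀ v w, minkB H (g v) (g w) = minkB H v w) ∧
    ∀ v, v ∈ Hyp H ↔ g v ∈ Hyp H}
  one_mem' := ⟨fun _ _ => rfl, fun _ => Iff.rfl⟩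
  mul_mem' := by
    rintro a b ⟨ha1, ha2⟩ ⟨hb1, hb2⟩
    refine ⟨fun v w => ?_, fun v => ?_⟩
    · show minkB H (a (b v)) (a (b w)) = _
      rw [ha1, hb1]
    · show v ∈ Hyp H ↔ a (b v) ∈ Hyp H
      rw [← ha2, ← hb2]
  inv_mem' := by
    rintro a ⟨ha1, ha2⟩
    refine ⟨fun v w => ?_, fun v => ?_⟩
    · show minkB H (a.symm v) (a.symm w) = minkB H v w
      conv_rhs => rw [← a.apply_symm_apply v, ← a.apply_symm_apply w, ha1]
    · show v ∈ Hyp H ↔ a.symm v ∈ Hyp H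
      conv_lhs => rw [← a.apply_symm_apply v, ← ha2]


/-- The topology of pointwise convergence on `O₊(B)`: the coarsest topology making
`g ↦ g x` continuous for every `x ∈ ℝ × H`. -/
noncomputable def ptTop (H : Type*) [NormedAddCommGroup H] [InnerProductSpace ℝ H] :
    TopologicalSpace (Oplus H) :=
  TopologicalSpace.induced (fun g : Oplus H => fun v : ℝ × H => g.1 v)
    Pi.topologicalSpace

/-- A (pseudo-)length function on a group: subadditive and symmetric. -/
structure IsLength {G : Type*} [Group G] (L : G → ℝ) : Prop where
  mul_le : ∀ g h, L (g * h) ≤ L g + L h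
  inv_eq : ∀ g, L g⁻¹ = L g

lemma IsLength.conj_le {G : Type*} [Group G] {L : G → ℝ} (hL : IsLength L) (k g : G) :
    L (k * g * k⁻¹) ≤ 2 * L k + L g := by
  have h1 := hL.mul_le (k * g) k⁻¹
  have h2 := hL.mul_le k g
  rw [hL.inv_eq] at h1
  linarith

lemma IsLength.le_conj {G : Type*} [Group G] {L : G → ℝ} (hL : IsLength L) (k g : G) :
    L g ≤ 2 * L k + L (k * g * k⁻¹) := by
  have h := hL.conj_le k⁻¹ (k * g * k⁻¹)
  rw [hL.inv_eq] at h
  convert h using 2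
  group

lemma IsLength.comp {G G' : Type*} [Group G] [Group G'] {L : G' → ℝ} (hL : IsLength L)
    (f : G →* G') : IsLength (fun g => L (f g)) :=
  ⟨fun g h => by rw [map_mul]; exact hL.mul_le _ _, fun g => by rw [map_inv]; exact hL.inv_eq _⟩

/-- An uncountable family in a separable space has two arbitrarily close members. -/
lemma exists_ne_dist_lt_of_uncountable {α X : Type*} [PseudoMetricSpace X]
    [TopologicalSpace.SeparableSpace X] [Uncountable α] (f : α → X) {ε : ℝ} (hε : 0 < ε) :
    ∃ a b, a ≠ b ∧ dist (f a) (f b) < ε := by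
  obtain ⟨a₀⟩ : Nonempty α := inferInstance
  have : Nonempty X := ⟨f a₀⟩
  have hd := TopologicalSpace.denseRange_denseSeq X
  have h : ∀ a, ∃ n, dist (f a) (TopologicalSpace.denseSeq X n) < ε / 2 := fun a =>
    hd.exists_dist_lt (f a) (half_pos hε)
  choose n hn using h
  have hni : ¬ Function.Injective n := fun hi => not_countable hi.countable
  simp only [Function.Injective, not_forall] at hni
  obtain ⟨a, b, hab, hne⟩ := hni
  refine ⟨a, b, hne, ?_⟩
  have h1 := hn a
  have h2 := hn b
  rw [← hab] at h2
  linarith [dist_triangle_right (f a) (f b) (TopologicalSpace.denseSeq X (n a))]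

lemma Orthonormal.countable_of_separableSpace {ι E : Type*} [NormedAddCommGroup E]
    [InnerProductSpace ℝ E] [TopologicalSpace.SeparableSpace E] {b : ι → E}
    (hb : Orthonormal ℝ b) : Countable ι := by
  by_contra h
  have : Uncountable ι := ⟨h⟩
  obtain ⟨i, j, hij, hd⟩ := exists_ne_dist_lt_of_uncountable b one_pos
  rw [dist_eq_norm] at hd
  have h1 : ‖b i - b j‖ ^ 2 = 2 := by
    rw [norm_sub_sq_real, hb.1 i, hb.1 j, hb.2 hij]; norm_num
  nlinarith [norm_nonneg (b i - b j)]

section l2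

variable {ι E : Type*} [NormedAddCommGroup E] [InnerProductSpace ℝ E]

lemma memℓp_monomial (u : ι → E ≃ₗᵢ[ℝ] E) (σ : Equiv.Perm ι) (x : lp (fun _ : ι => E) 2) :
    Memℓp (fun i => u i (x (σ i))) 2 := by
  have h2 : 0 < (2 : ENNReal).toReal := by norm_num
  rw [memℓp_gen_iff h2]
  have := (memℓp_gen_iff h2).1 (lp.memℓp x)
  simp only [LinearIsometryEquiv.norm_map]
  exact (σ.summable_iff).2 this

/-- The isometry of `ℓ²(ι, E)` which permutes the coordinates and acts on each of them by a linear
isometry of `E`. -/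
noncomputable def l2Monomial (u : ι → E ≃ₗᵢ[ℝ] E) (σ : Equiv.Perm ι) :
    lp (fun _ : ι => E) 2 ≃ₗᵢ[ℝ] lp (fun _ : ι => E) 2 where
  toFun x := ⟨fun i => u i (x (σ i)), memℓp_monomial u σ x⟩
  invFun x := ⟨fun i => (u (σ.symm i)).symm (x (σ.symm i)),
    memℓp_monomial (fun i => (u (σ.symm i)).symm) σ.symm x⟩
  map_add' x y := by ext i; exact map_add (u i) _ _
  map_smul' c x := by ext i; exact map_smul (u i) _ _
  left_inv x := by ext i; simp
  right_inv x := by ext i; simp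
  norm_map' x := by
    have h2 : 0 < (2 : ENNReal).toReal := by norm_num
    rw [lp.norm_eq_tsum_rpow h2, lp.norm_eq_tsum_rpow h2]
    congr 1
    rw [← σ.tsum_eq fun i => ‖x i‖ ^ (2 : ENNReal).toReal]
    exact tsum_congr fun i => congrArg (· ^ _) ((u i).norm_map _)

lemma l2Monomial_apply (u : ι → E ≃ₗᵢ[ℝ] E) (σ : Equiv.Perm ι) (x : lp (fun _ : ι => E) 2)
    (i : ι) : l2Monomial u σ x i = u i (x (σ i)) := rfl

end l2

/-- The permutation of `ℕ × ℤ` shifting the fibre over `n` and fixing all other points. -/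
def fibreShift (n : ℕ) : Equiv.Perm (ℕ × ℤ) where
  toFun p := if p.1 = n then (p.1, p.2 - 1) else p
  invFun p := if p.1 = n then (p.1, p.2 + 1) else p
  left_inv p := by
    by_cases h : p.1 = n <;> simp [h]
    ext <;> simp [h]
  right_inv p := by
    by_cases h : p.1 = n <;> simp [h]
    ext <;> simp [h]

/-- A length function on the isometry group of `ℓ²(ℕ × ℤ, E)` is bounded on the isometries acting
on a single coordinate. -/
lemma IsLength.bounded_on_single {E : Type*} [NormedAddCommGroup E] [InnerProductSpace ℝ E]
    {L : (lp (fun _ : ℕ × ℤ => E) 2 ≃ₗᵢ[ℝ] lp (fun _ : ℕ × ℤ => E) 2) → ℝ} (hL : IsLength L) :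
    ∃ C, ∀ g : E ≃ₗᵢ[ℝ] E, L (l2Monomial (Pi.mulSingle (0, 0) g) 1) ≤ C := by
  by_contra! hcon
  set τ : ℕ → Equiv.Perm (ℕ × ℤ) := fun n => Equiv.swap (0, 0) (n, 0) with hτ
  choose g hg using fun n : ℕ => hcon
    (n + 2 * L (l2Monomial 1 (τ n)) + 2 * L (l2Monomial 1 (fibreShift n)))
  set T := l2Monomial (fun p : ℕ × ℤ => if 0 ≤ p.2 then g p.1 else 1) 1 with hT
  have key : ∀ n, L (l2Monomial (Pi.mulSingle (0, 0) (g n)) 1) ≤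
      2 * L (l2Monomial 1 (τ n)) + 2 * L (l2Monomial 1 (fibreShift n)) + 2 * L T := by
    intro n
    have h1 : l2Monomial (Pi.mulSingle (n, 0) (g n)) 1 * (l2Monomial 1 (fibreShift n) * T) =
        T * l2Monomial 1 (fibreShift n) := by
      ext x p
      simp only [hT, LinearIsometryEquiv.coe_mul, Function.comp_apply, l2Monomial_apply,
        Pi.one_apply, Equiv.Perm.coe_one, id_eq, LinearIsometryEquiv.coe_one]
      obtain ⟨m, k⟩ := p
      by_cases hm : m = n
      · subst hm
        simp only [fibreShift, Equiv.coe_fn_mk, if_true]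
        rcases lt_trichotomy k 0 with hk | hk | hk
        · have : ¬ (1 ≤ k) := by omega
          have : ¬ (0 ≤ k) := by omega
          have hne : ((m, k) : ℕ × ℤ) ≠ (m, 0) := by simp; omega
          simp [*]
        · subst hk
          simp
        · have : 1 ≤ k := by omega
          have : (0 ≤ k) := by omega
          have hne : ((m, k) : ℕ × ℤ) ≠ (m, 0) := by simp; omega
          simp [*]
      · have hne : ((m, k) : ℕ × ℤ) ≠ (n, 0) := by simp [hm]
        simp [fibreShift, hm, hne]
    have h2 : l2Monomial (Pi.mulSingle (0, 0) (g n)) 1 * l2Monomial 1 (τ n) =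
        l2Monomial 1 (τ n) * l2Monomial (Pi.mulSingle (n, 0) (g n)) 1 := by
      ext x p
      simp only [LinearIsometryEquiv.coe_mul, Function.comp_apply, l2Monomial_apply,
        Pi.one_apply, Equiv.Perm.coe_one, id_eq, LinearIsometryEquiv.coe_one]
      have : (Pi.mulSingle (n, 0) (g n) : ℕ × ℤ → E ≃ₗᵢ[ℝ] E) (τ n p) =
          (Pi.mulSingle (0, 0) (g n) : ℕ × ℤ → E ≃ₗᵢ[ℝ] E) p := by
        have hp : τ n p = (n, 0) ↔ p = (0, 0) := by
          rw [← (τ n).injective.eq_iff (a := p) (b := (0, 0))]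
          simp [hτ]
        simp only [Pi.mulSingle_apply, hp]
      rw [this]
    have h3 := hL.conj_le (l2Monomial 1 (τ n)) (l2Monomial (Pi.mulSingle (n, 0) (g n)) 1)
    rw [← h2, mul_inv_cancel_right] at h3
    rw [← eq_mul_inv_iff_mul_eq] at h1
    have h4 := hL.mul_le (T * l2Monomial 1 (fibreShift n)) (l2Monomial 1 (fibreShift n) * T)⁻¹
    rw [hL.inv_eq, ← h1] at h4
    linarith [hL.mul_le T (l2Monomial 1 (fibreShift n)),
      hL.mul_le (l2Monomial 1 (fibreShift n)) T]
  obtain ⟨n, hn⟩ := exists_nat_gt (2 * L T)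
  linarith [key n, hg n]

section absorb

variable {E : Type*} [NormedAddCommGroup E] [InnerProductSpace ℝ E]

lemma orthonormal_single {κ ι : Type*} [DecidableEq ι] {b : κ → E} (hb : Orthonormal ℝ b) :
    Orthonormal ℝ (fun q : ι × κ => lp.single (E := fun _ : ι => E) 2 q.1 (b q.2)) := by
  refine ⟨fun q => ?_, fun q r hqr => ?_⟩
  · rw [lp.norm_single (by norm_num)]
    exact hb.1 _
  · dsimp only
    rw [lp.inner_single_left, lp.single_apply]
    by_cases h : q.1 = r.1
    · rw [h, Pi.single_eq_same]
      exact hb.2 fun h' => hqr (Prod.ext h h')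
    · rw [Pi.single_eq_of_ne h, inner_zero_right]

lemma HilbertBasis.ext_inner {κ : Type*} (b : HilbertBasis κ ℝ E) {x y : E}
    (h : ∀ i, inner ℝ (b i) x = inner ℝ (b i) y) : x = y := by
  apply b.repr.injective
  ext i
  rw [b.repr_apply_apply, b.repr_apply_apply, h]

variable [CompleteSpace E]

/-- The Hilbert basis of `ℓ²(ι, E)` coming from a Hilbert basis of `E`. -/
noncomputable def HilbertBasis.l2Sum {κ : Type*} (b : HilbertBasis κ ℝ E) (ι : Type*)
    [DecidableEq ι] : HilbertBasis (ι × κ) ℝ (lp (fun _ : ι => E) 2) :=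
  HilbertBasis.mkOfOrthogonalEqBot (orthonormal_single b.orthonormal) <| by
    rw [Submodule.eq_bot_iff]
    intro x hx
    ext i
    refine b.ext_inner fun m => ?_
    have := (Submodule.mem_orthogonal _ _).1 hx _ (Submodule.subset_span ⟨(i, m), rfl⟩)
    rw [lp.inner_single_left] at this
    exact this.trans (inner_zero_right _).symm

lemma HilbertBasis.l2Sum_apply {κ : Type*} (b : HilbertBasis κ ℝ E) (ι : Type*)
    [DecidableEq ι] (q : ι × κ) :
    b.l2Sum ι q = lp.single (E := fun _ : ι => E) 2 q.1 (b q.2) := by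
  simp [HilbertBasis.l2Sum]

/-- Reindexing a Hilbert basis. -/
noncomputable def HilbertBasis.reindexAlong {κ κ' : Type*} (b : HilbertBasis κ ℝ E) (θ : κ' ≃ κ) :
    HilbertBasis κ' ℝ E :=
  HilbertBasis.mk (b.orthonormal.comp θ θ.injective) <| by
    rw [θ.surjective.range_comp, b.dense_span]

lemma HilbertBasis.reindexAlong_apply {κ κ' : Type*} (b : HilbertBasis κ ℝ E) (θ : κ' ≃ κ)
    (i : κ') : b.reindexAlong θ i = b (θ i) := by
  simp [HilbertBasis.reindexAlong]

/-- A decomposition of `E` as an infinite `ℓ²`-sum of copies of `E` turning all isometries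
which fix a given orthonormal sequence into isometries acting on one coordinate only. -/
lemma exists_equiv_l2Sum [TopologicalSpace.SeparableSpace E] {e : ℕ → E} (he : Orthonormal ℝ e) :
    ∃ v : E ≃ₗᵢ[ℝ] lp (fun _ : ℕ × ℤ => E) 2, ∀ g : E ≃ₗᵢ[ℝ] E, (∀ i, g (e i) = e i) →
      ∀ x, v (g x) = l2Monomial (Pi.mulSingle (0, 0) g) 1 (v x) := by
  classical
  obtain ⟨w, b, hsw, hbw⟩ := he.toSubtypeRange.exists_hilbertBasis_extension
  set S := Set.range e
  have hb : ∀ t : w, b t = t := fun t => congrFun hbw t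
  have hwc : Countable w := b.orthonormal.countable_of_separableSpace
  set P : w → Prop := fun t => (t : E) ∉ S with hP
  set Q : (ℕ × ℤ) × w → Prop := fun q => q.1 = (0, 0) ∧ P q.2 with hQ
  let θ₁ : {t // P t} ≃ {q // Q q} :=
  { toFun := fun t => ⟨((0, 0), t.1), rfl, t.2⟩
    invFun := fun q => ⟨q.1.2, q.2.2⟩
    left_inv := fun t => rfl
    right_inv := fun q => Subtype.ext (Prod.ext q.2.1.symm rfl) }
  have hi1 : Infinite {t // ¬ P t} :=
    Infinite.of_injective (fun i : ℕ => ⟨⟨e i, hsw ⟨i, rfl⟩⟩, not_not.2 ⟨i, rfl⟩⟩) fun i j hij =>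
      he.linearIndependent.injective (congrArg (fun t => ((t : {t // ¬ P t}).1 : E)) hij)
  have hi2 : Infinite {q // ¬ Q q} :=
    Infinite.of_injective (fun i : ℕ => ⟨((i + 1, 0), ⟨e 0, hsw ⟨0, rfl⟩⟩), fun h => by
      simpa using congrArg (fun p : ℕ × ℤ => p.1) h.1⟩) fun i j hij => by simpa using hij
  obtain ⟨θ₂⟩ : Nonempty ({t // ¬ P t} ≃ {q // ¬ Q q}) := nonempty_equiv_of_countable
  let θ : w ≃ (ℕ × ℤ) × w :=
    ((Equiv.sumCompl P).symm.trans (Equiv.sumCongr θ₁ θ₂)).trans (Equiv.sumCompl Q)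
  have hθ₁ : ∀ t, P t → θ t = ((0, 0), t) := fun t ht => by
    simp [θ, θ₁, Equiv.sumCompl_symm_apply_of_pos ht]
  have hθ₂ : ∀ t, ¬ P t → ¬ Q (θ t) := fun t ht => by
    simp only [θ, Equiv.trans_apply, Equiv.sumCompl_symm_apply_of_neg ht]
    exact (θ₂ ⟨t, ht⟩).2
  set b' := (b.l2Sum (ℕ × ℤ)).reindexAlong θ with hb'
  set v : E ≃ₗᵢ[ℝ] lp (fun _ : ℕ × ℤ => E) 2 := b.repr.trans b'.repr.symm with hv
  have hvb : ∀ t : w, v t = lp.single (E := fun _ : ℕ × ℤ => E) 2 (θ t).1 ((θ t).2 : E) := by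
    intro t
    rw [← hb t, hv, LinearIsometryEquiv.trans_apply, b.repr_self, b'.repr_symm_single, hb',
      HilbertBasis.reindexAlong_apply, HilbertBasis.l2Sum_apply, hb]
  have hvS : ∀ y : E, (∀ i, inner ℝ (e i) y = 0) →
      v y = lp.single (E := fun _ : ℕ × ℤ => E) 2 (0, 0) y := by
    intro y hy
    refine b'.ext_inner fun t => ?_
    have ht : b' t = v t := by
      rw [hvb, hb', HilbertBasis.reindexAlong_apply, HilbertBasis.l2Sum_apply, hb]
    rw [ht, v.inner_map_map, hvb, lp.inner_single_left, lp.single_apply]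
    by_cases hPt : P t
    · rw [hθ₁ t hPt, Pi.single_eq_same]
    · obtain ⟨i, hi⟩ : (t : E) ∈ S := not_not.1 hPt
      rw [← hi, hy]
      by_cases h0 : (θ t).1 = (0, 0)
      · have h1 : ¬ P (θ t).2 := fun h => hθ₂ t hPt ⟨h0, h⟩
        obtain ⟨j, hj⟩ : ((θ t).2 : E) ∈ S := not_not.1 h1
        rw [h0, Pi.single_eq_same, ← hj, hy]
      · rw [Pi.single_eq_of_ne h0, inner_zero_right]
  refine ⟨v, fun g hg => ?_⟩
  set m := l2Monomial (Pi.mulSingle (0, 0) g : ℕ × ℤ → E ≃ₗᵢ[ℝ] E) 1 with hm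
  have hms : ∀ y, m (lp.single (E := fun _ : ℕ × ℤ => E) 2 (0, 0) y) =
      lp.single (E := fun _ : ℕ × ℤ => E) 2 (0, 0) (g y) := by
    intro y
    ext q
    rw [hm, l2Monomial_apply, Equiv.Perm.one_apply, lp.single_apply, lp.single_apply]
    by_cases hq : q = (0, 0)
    · subst hq; simp
    · simp [hq]
  have hmain : ((v : E →L[ℝ] lp (fun _ : ℕ × ℤ => E) 2).comp (g : E →L[ℝ] E)) =
      (m : lp (fun _ : ℕ × ℤ => E) 2 →L[ℝ] lp (fun _ : ℕ × ℤ => E) 2).comp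
        (v : E →L[ℝ] lp (fun _ : ℕ × ℤ => E) 2) := by
    refine ContinuousLinearMap.ext_on (s := Set.range b)
      (Submodule.dense_iff_topologicalClosure_eq_top.2 b.dense_span) ?_
    rintro _ ⟨t, rfl⟩
    change v (g (b t)) = m (v (b t))
    rw [hb]
    by_cases hPt : P t
    · have horth : ∀ i, inner ℝ (e i) (t : E) = 0 := fun i => by
        have hne : (⟨e i, hsw ⟨i, rfl⟩⟩ : w) ≠ t := fun h => hPt ⟨i, congrArg Subtype.val h⟩
        have : inner ℝ (b ⟨e i, hsw ⟨i, rfl⟩⟩) (b t) = 0 := b.orthonormal.2 hne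
        rwa [hb, hb] at this
      rw [hvS _ horth, hms, hvS]
      intro i
      rw [← hg i, g.inner_map_map, horth]
    · obtain ⟨i, hi⟩ : (t : E) ∈ S := not_not.1 hPt
      rw [← hi, hg, hi, hvb]
      by_cases h0 : (θ t).1 = (0, 0)
      · have h1 : ¬ P (θ t).2 := fun h => hθ₂ t hPt ⟨h0, h⟩
        obtain ⟨j, hj⟩ : ((θ t).2 : E) ∈ S := not_not.1 h1
        rw [h0, hms, ← hj, hg]
      · ext q
        rw [hm, l2Monomial_apply, Equiv.Perm.one_apply, lp.single_apply]
        by_cases hq : q = (0, 0)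
        · rw [hq, Pi.single_eq_of_ne (Ne.symm h0), map_zero]
        · rw [Pi.mulSingle_eq_of_ne hq, LinearIsometryEquiv.coe_one, id]
  exact fun x => congrArg (fun f => f x) hmain

lemma IsLength.bounded_on_fixing [TopologicalSpace.SeparableSpace E]
    {L : (E ≃ₗᵢ[ℝ] E) → ℝ} (hL : IsLength L) {e : ℕ → E} (he : Orthonormal ℝ e) :
    ∃ C, ∀ g : E ≃ₗᵢ[ℝ] E, (∀ i, g (e i) = e i) → L g ≤ C := by
  obtain ⟨v, hv⟩ := exists_equiv_l2Sum he
  have hL' : IsLength (fun m : lp (fun _ : ℕ × ℤ => E) 2 ≃ₗᵢ[ℝ] lp (fun _ : ℕ × ℤ => E) 2 =>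
      L ((v.trans m).trans v.symm)) := by
    refine ⟨fun g h => ?_, fun g => ?_⟩
    · refine le_of_eq_of_le (congrArg L ?_) (hL.mul_le _ _)
      ext x
      simp
    · rw [← hL.inv_eq]
      rfl
  obtain ⟨C, hC⟩ := hL'.bounded_on_single
  refine ⟨C, fun g hg => le_of_eq_of_le (congrArg L ?_) (hC g)⟩
  ext x
  simp [← hv g hg]

end absorb

section factorization

variable {E : Type*} [NormedAddCommGroup E] [InnerProductSpace ℝ E]

lemma Orthonormal.not_finiteDimensional_span {e : ℕ → E} (he : Orthonormal ℝ e) :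
    ¬ FiniteDimensional ℝ (Submodule.span ℝ (Set.range e)) := fun _ =>
  not_finite_iff_infinite.2 inferInstance (linearIndependent_span he.linearIndependent).finite

/-- An infinite-dimensional subspace contains unit vectors orthogonal to any given finite set. -/
lemma exists_unit_mem_orthogonal {V : Submodule ℝ E} (hV : ¬ FiniteDimensional ℝ V)
    (s : Finset E) : ∃ x ∈ V, ‖x‖ = 1 ∧ ∀ y ∈ s, inner ℝ y x = 0 := by
  let f : V →ₗ[ℝ] (s → ℝ) := LinearMap.pi fun y => (innerₗ E (y : E)).comp V.subtype
  have hf : ¬ Function.Injective f := fun h => hV (FiniteDimensional.of_injective f h)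
  rw [← LinearMap.ker_eq_bot, Submodule.eq_bot_iff] at hf
  push Not at hf
  obtain ⟨x, hx, hx0⟩ := hf
  have hx0' : (x : E) ≠ 0 := fun h => hx0 (Subtype.ext h)
  refine ⟨‖(x : E)‖⁻¹ • (x : E), V.smul_mem _ x.2, ?_, ?_⟩
  · rw [norm_smul, norm_inv, norm_norm, inv_mul_cancel₀ (norm_ne_zero_iff.2 hx0')]
  · intro y hy
    have : inner ℝ y (x : E) = 0 := congrFun (LinearMap.mem_ker.1 hx) ⟨y, hy⟩
    rw [inner_smul_right, this, mul_zero]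

lemma exists_orthonormal_seq (hinf : ¬ FiniteDimensional ℝ E) :
    ∃ e : ℕ → E, Orthonormal ℝ e := by
  have htop : ¬ FiniteDimensional ℝ (⊤ : Submodule ℝ E) := fun h =>
    hinf (Submodule.topEquiv.finiteDimensional (V := (⊤ : Submodule ℝ E)))
  have : Std.Symm (fun x y : E => inner ℝ x y = (0 : ℝ)) :=
    ⟨fun x y h => by rw [real_inner_comm]; exact h⟩
  obtain ⟨e, he1, he2⟩ := exists_seq_of_forall_finset_exists' (fun x : E => ‖x‖ = 1)
    (fun x y => inner ℝ x y = (0 : ℝ)) fun s _ => by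
      obtain ⟨x, -, hx1, hx2⟩ := exists_unit_mem_orthogonal htop s
      exact ⟨x, hx1, hx2⟩
  exact ⟨e, he1, he2⟩

variable [CompleteSpace E]

/-- Simultaneous exchange of the vectors `u i` and `v i` by a reflection. -/
lemma exists_isometry_exchange {u v : ℕ → E} (hn : ∀ i, ‖u i‖ = ‖v i‖)
    (huu : ∀ i j, i ≠ j → inner ℝ (u i) (u j) = 0) (huv : ∀ i j, i ≠ j → inner ℝ (u i) (v j) = 0)
    (hvv : ∀ i j, i ≠ j → inner ℝ (v i) (v j) = 0) :
    ∃ k : E ≃ₗᵢ[ℝ] E, (∀ i, k (u i) = v i) ∧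
      ∀ y, (∀ i, inner ℝ (u i - v i) y = 0) → k y = y := by
  set W := Submodule.span ℝ (Set.range fun i => u i - v i)
  have hmem : ∀ y, (∀ i, inner ℝ (u i - v i) y = 0) → y ∈ Wᗮ := by
    intro y hy
    have : W ≤ (ℝ ∙ y)ᗮ := by
      refine Submodule.span_le.2 ?_
      rintro _ ⟨i, rfl⟩
      exact Submodule.mem_orthogonal_singleton_iff_inner_left.2 (hy i)
    exact fun x hx => Submodule.mem_orthogonal_singleton_iff_inner_left.1 (this hx)
  have hc : CompleteSpace Wᗮ := W.isClosed_orthogonal.completeSpace_coe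
  have hfix : ∀ y, (∀ i, inner ℝ (u i - v i) y = 0) → Wᗮ.reflection y = y := fun y hy =>
    Submodule.reflection_mem_subspace_eq_self (hmem y hy)
  refine ⟨Wᗮ.reflection, fun i => ?_, hfix⟩
  have h1 : Wᗮ.reflection (u i - v i) = -(u i - v i) :=
    Submodule.reflection_mem_subspace_orthogonalComplement_eq_neg
      (W.le_orthogonal_orthogonal (Submodule.subset_span ⟨i, rfl⟩))
  have h2 : Wᗮ.reflection (u i + v i) = u i + v i := by
    refine hfix _ fun j => ?_
    by_cases hj : j = i
    · subst hj
      rw [real_inner_comm]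
      exact (real_inner_add_sub_eq_zero_iff _ _).2 (hn j)
    · have huv' := huv i j (Ne.symm hj)
      rw [real_inner_comm] at huv'
      rw [inner_sub_left, inner_add_right, inner_add_right, huu j i hj, huv j i hj, huv',
        hvv j i hj]
      ring
  have h3 : u i = (2⁻¹ : ℝ) • ((u i + v i) + (u i - v i)) := by module
  rw [h3, map_smul, map_add, h1, h2]
  module

lemma IsLength.bounded_on_fixing_uniform [TopologicalSpace.SeparableSpace E]
    (hinf : ¬ FiniteDimensional ℝ E) {L : (E ≃ₗᵢ[ℝ] E) → ℝ} (hL : IsLength L) :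
    ∃ C, ∀ x : ℕ → E, Orthonormal ℝ x → ∀ g : E ≃ₗᵢ[ℝ] E, (∀ i, g (x i) = x i) → L g ≤ C := by
  obtain ⟨q, hq⟩ := exists_orthonormal_seq hinf
  have hqo : ∀ a : Fin 4, Orthonormal ℝ (fun n => q (4 * n + a)) := fun a =>
    hq.comp _ fun m n h => by simpa using h
  choose C hC using fun a => hL.bounded_on_fixing (hqo a)
  have hqq : ∀ (a b : Fin 4) m n, a ≠ b → inner ℝ (q (4 * m + a)) (q (4 * n + b)) = 0 :=
    fun a b m n hab => hq.2 (by omega)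
  set A : Submodule ℝ E := (Submodule.span ℝ
    (Set.range (fun n => q (4 * n + (2 : Fin 4))) ∪ Set.range (fun n => q (4 * n + (3 : Fin 4)))))ᗮ
   
  have hAc : CompleteSpace A := (Submodule.isClosed_orthogonal _).completeSpace_coe
  set P := A.starProjection
  have hPm : ∀ x, P x ∈ A := fun x => A.starProjection_apply_mem x
  have hPo : ∀ x, x - P x ∈ Aᗮ := fun x => A.sub_starProjection_mem_orthogonal x
  have hPin : ∀ x, ∀ y ∈ A, inner ℝ (P x) y = inner ℝ x y := fun x y hy => by
    have := Submodule.inner_left_of_mem_orthogonal hy (hPo x)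
    rw [inner_sub_left] at this
    linarith
  have hAA : ∀ x ∈ A, ∀ y ∈ Aᗮ, inner ℝ x y = 0 := fun x hx y hy => hy x hx
  have hmemA : ∀ a : Fin 4, a ≠ 2 → a ≠ 3 → ∀ n, q (4 * n + a) ∈ A := by
    intro a h2 h3 n
    have : Submodule.span ℝ (Set.range (fun n => q (4 * n + (2 : Fin 4))) ∪
        Set.range (fun n => q (4 * n + (3 : Fin 4)))) ≤ (ℝ ∙ q (4 * n + a))ᗮ := by
      refine Submodule.span_le.2 ?_
      rintro _ (⟨i, rfl⟩ | ⟨i, rfl⟩)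
      · exact Submodule.mem_orthogonal_singleton_iff_inner_left.2 (hqq _ _ _ _ h2.symm)
      · exact Submodule.mem_orthogonal_singleton_iff_inner_left.2 (hqq _ _ _ _ h3.symm)
    exact fun x hx => Submodule.mem_orthogonal_singleton_iff_inner_left.1 (this hx)
  have hmemA2 : ∀ n, q (4 * n + (2 : Fin 4)) ∈ Aᗮ := fun n =>
    Submodule.le_orthogonal_orthogonal _ (Submodule.subset_span (Or.inl ⟨n, rfl⟩))
  set V₀ := Submodule.span ℝ (Set.range fun n => q (4 * n + (0 : Fin 4)))
  set V₂ := Submodule.span ℝ (Set.range fun n => q (4 * n + (2 : Fin 4)))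
  have hV₀A : V₀ ≤ A := Submodule.span_le.2 <| by
    rintro _ ⟨n, rfl⟩; exact hmemA 0 (by decide) (by decide) n
  have hV₂A : V₂ ≤ Aᗮ := Submodule.span_le.2 <| by
    rintro _ ⟨n, rfl⟩; exact hmemA2 n
  have hV₀q : ∀ x ∈ V₀, ∀ a : Fin 4, a ≠ 0 → ∀ n, inner ℝ x (q (4 * n + a)) = 0 := by
    intro x hx a ha n
    have : V₀ ≤ (ℝ ∙ q (4 * n + a))ᗮ := Submodule.span_le.2 <| by
      rintro _ ⟨i, rfl⟩
      exact Submodule.mem_orthogonal_singleton_iff_inner_left.2 (hqq _ _ _ _ ha.symm)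
    exact Submodule.mem_orthogonal_singleton_iff_inner_left.1 (this hx)
  have hV₂q : ∀ x ∈ V₂, ∀ a : Fin 4, a ≠ 2 → ∀ n, inner ℝ x (q (4 * n + a)) = 0 := by
    intro x hx a ha n
    have : V₂ ≤ (ℝ ∙ q (4 * n + a))ᗮ := Submodule.span_le.2 <| by
      rintro _ ⟨i, rfl⟩
      exact Submodule.mem_orthogonal_singleton_iff_inner_left.2 (hqq _ _ _ _ ha.symm)
    exact Submodule.mem_orthogonal_singleton_iff_inner_left.1 (this hx)
  refine ⟨2 * (C 3 + C 0 + C 2) + C 1, fun X hX g hg => ?_⟩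
  set V := Submodule.span ℝ (Set.range X)
  have hgV : ∀ x ∈ V, g x = x := by
    intro x hx
    induction hx using Submodule.span_induction with
    | mem x h => obtain ⟨i, rfl⟩ := h; exact hg i
    | zero => exact map_zero g
    | add x y _ _ hx hy => rw [map_add, hx, hy]
    | smul c x _ hx => rw [map_smul, hx]
  let r : E × E × E → E × E × E → Prop := fun s t =>
    inner ℝ s.1 t.1 = 0 ∧ inner ℝ (P s.1) (P t.1) = 0 ∧ inner ℝ s.2.1 t.2.1 = 0 ∧
      inner ℝ s.2.2 t.2.2 = 0 ∧ inner ℝ s.1 t.2.1 = 0 ∧ inner ℝ s.2.1 t.1 = 0 ∧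
      inner ℝ s.1 t.2.2 = 0 ∧ inner ℝ s.2.2 t.1 = 0
  have hr : Std.Symm r := ⟨fun s t ⟨h1, h2, h3, h4, h5, h6, h7, h8⟩ => by
    rw [real_inner_comm] at h1 h2 h3 h4 h5 h6 h7 h8
    exact ⟨h1, h2, h3, h4, h6, h5, h8, h7⟩⟩
  obtain ⟨s, hs, hsr⟩ := exists_seq_of_forall_finset_exists' (fun s : E × E × E =>
      (s.1 ∈ V ∧ ‖s.1‖ = 1) ∧ (s.2.1 ∈ V₀ ∧ ‖s.2.1‖ = 1) ∧ (s.2.2 ∈ V₂ ∧ ‖s.2.2‖ = 1)) r <| by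
    classical
    intro S _
    obtain ⟨x, hxV, hx1, hx⟩ := exists_unit_mem_orthogonal hX.not_finiteDimensional_span
      (S.image (fun s => s.1) ∪ S.image (fun s => P s.1) ∪ S.image (fun s => s.2.1) ∪
        S.image (fun s => s.2.2))
    obtain ⟨e, heV, he1, he⟩ := exists_unit_mem_orthogonal (hqo 0).not_finiteDimensional_span
      (S.image (fun s => s.1) ∪ S.image (fun s => s.2.1))
    obtain ⟨f, hfV, hf1, hf⟩ := exists_unit_mem_orthogonal (hqo 2).not_finiteDimensional_span
      (S.image (fun s => s.1) ∪ S.image (fun s => s.2.2))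
    refine ⟨(x, e, f), ⟨⟨hxV, hx1⟩, ⟨heV, he1⟩, ⟨hfV, hf1⟩⟩, fun t ht => ?_⟩
    have m1 := Finset.mem_image_of_mem (fun s : E × E × E => s.1) ht
    have m2 := Finset.mem_image_of_mem (fun s : E × E × E => P s.1) ht
    have m3 := Finset.mem_image_of_mem (fun s : E × E × E => s.2.1) ht
    have m4 := Finset.mem_image_of_mem (fun s : E × E × E => s.2.2) ht
    refine ⟨hx _ ?_, ?_, he _ ?_, hf _ ?_, he _ ?_, hx _ ?_, hf _ ?_, hx _ ?_⟩
    case refine_2 =>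
      rw [real_inner_comm, hPin _ _ (hPm _), real_inner_comm]
      exact hx _ (by simp only [Finset.mem_union]; tauto)
    all_goals simp only [Finset.mem_union]; tauto
  set x := fun i => (s i).1
  set e := fun i => (s i).2.1
  set f := fun i => (s i).2.2
  have hxV : ∀ i, x i ∈ V := fun i => (hs i).1.1
  have hx1 : ∀ i, ‖x i‖ = 1 := fun i => (hs i).1.2
  have heV : ∀ i, e i ∈ V₀ := fun i => (hs i).2.1.1
  have he1 : ∀ i, ‖e i‖ = 1 := fun i => (hs i).2.1.2
  have hfV : ∀ i, f i ∈ V₂ := fun i => (hs i).2.2.1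
  have hf1 : ∀ i, ‖f i‖ = 1 := fun i => (hs i).2.2.2
  have hxx : ∀ i j, i ≠ j → inner ℝ (x i) (x j) = 0 := fun i j h => (hsr h).1
  have hPP : ∀ i j, i ≠ j → inner ℝ (P (x i)) (P (x j)) = 0 := fun i j h => (hsr h).2.1
  have hee : ∀ i j, i ≠ j → inner ℝ (e i) (e j) = 0 := fun i j h => (hsr h).2.2.1
  have hff : ∀ i j, i ≠ j → inner ℝ (f i) (f j) = 0 := fun i j h => (hsr h).2.2.2.1
  have hxe : ∀ i j, i ≠ j → inner ℝ (x i) (e j) = 0 := fun i j h => (hsr h).2.2.2.2.1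
  have hxf : ∀ i j, i ≠ j → inner ℝ (x i) (f j) = 0 := fun i j h => (hsr h).2.2.2.2.2.2.1
  clear_value x e f
  have heA : ∀ i, e i ∈ A := fun i => hV₀A (heV i)
  have hfA : ∀ i, f i ∈ Aᗮ := fun i => hV₂A (hfV i)
  have hef : ∀ i j, inner ℝ (e i) (f j) = 0 := fun i j => hAA _ (heA i) _ (hfA j)
  have hfe : ∀ i j, inner ℝ (f i) (e j) = 0 := fun i j => by rw [real_inner_comm, hef]
  set a := fun i => P (x i)
  set b := fun i => x i - P (x i)
  have haA : ∀ i, a i ∈ A := fun i => hPm _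
  have hbA : ∀ i, b i ∈ Aᗮ := fun i => hPo _
  have hxab : ∀ i, x i = a i + b i := fun i => by simp [a, b]
  have hab1 : ∀ i, ‖a i‖ ^ 2 + ‖b i‖ ^ 2 = 1 := fun i => by
    have h := norm_add_sq_real (a i) (b i)
    rw [hAA _ (haA i) _ (hbA i), ← hxab, hx1] at h
    linarith
  have hae : ∀ i j, i ≠ j → inner ℝ (a i) (e j) = 0 := fun i j h => by
    rw [hPin _ _ (heA j), hxe i j h]
  have hbf : ∀ i j, i ≠ j → inner ℝ (b i) (f j) = 0 := fun i j h => by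
    rw [inner_sub_left, hxf i j h, hAA _ (hPm _) _ (hfA j), sub_zero]
  have hbb : ∀ i j, i ≠ j → inner ℝ (b i) (b j) = 0 := fun i j h => by
    have h1 := hxx i j h
    have h2 : inner ℝ (b i) (a j) = 0 := by
      rw [real_inner_comm]; exact hAA _ (haA j) _ (hbA i)
    rw [hxab i, hxab j, inner_add_left, inner_add_right, inner_add_right,
      hAA _ (haA i) _ (hbA j), hPP i j h, h2] at h1
    linarith
  obtain ⟨k₁, hk₁, hk₁'⟩ := exists_isometry_exchange (u := a) (v := fun i => ‖a i‖ • e i)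
    (fun i => by rw [norm_smul, he1, mul_one, norm_norm]) hPP
    (fun i j h => by rw [inner_smul_right, hae i j h, mul_zero])
    (fun i j h => by rw [inner_smul_left, inner_smul_right, hee i j h, mul_zero, mul_zero])
  have hk₁A : ∀ y ∈ Aᗮ, k₁ y = y := fun y hy => hk₁' y fun i =>
    hAA _ (A.sub_mem (haA i) (A.smul_mem _ (heA i))) y hy
  obtain ⟨k₂, hk₂, hk₂'⟩ := exists_isometry_exchange (u := b) (v := fun i => ‖b i‖ • f i)
    (fun i => by rw [norm_smul, hf1, mul_one, norm_norm]) hbb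
    (fun i j h => by rw [inner_smul_right, hbf i j h, mul_zero])
    (fun i j h => by rw [inner_smul_left, inner_smul_right, hff i j h, mul_zero, mul_zero])
  have hk₂A : ∀ y ∈ A, k₂ y = y := fun y hy => hk₂' y fun i => by
    rw [real_inner_comm]
    exact hAA _ hy _ (Aᗮ.sub_mem (hbA i) (Aᗮ.smul_mem _ (hfA i)))
  obtain ⟨k₃, hk₃, hk₃'⟩ := exists_isometry_exchange (u := fun i => ‖a i‖ • e i + ‖b i‖ • f i)
    (v := fun i => q (4 * i + (1 : Fin 4)))
    (fun i => by
      have h := norm_add_sq_real (‖a i‖ • e i) (‖b i‖ • f i)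
      rw [inner_smul_left, inner_smul_right, hef, norm_smul, norm_smul, norm_norm, norm_norm, he1,
        hf1, mul_one, mul_one, mul_zero, mul_zero, mul_zero, add_zero, hab1] at h
      rw [hq.1]
      exact (pow_eq_one_iff_of_nonneg (norm_nonneg _) two_ne_zero).1 h)
    (fun i j h => by
      simp only [inner_add_left, inner_add_right, inner_smul_left, inner_smul_right, hee i j h,
        hff i j h, hef, hfe, mul_zero, add_zero])
    (fun i j h => by
      simp only [inner_add_left, inner_smul_left, hV₀q _ (heV i) 1 (by decide),
        hV₂q _ (hfV i) 1 (by decide), mul_zero, add_zero])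
    (fun i j h => hq.2 (by omega))
  have hk₃q : ∀ n, k₃ (q (4 * n + (3 : Fin 4))) = q (4 * n + (3 : Fin 4)) := fun n =>
    hk₃' _ fun i => by
      rw [inner_sub_left, inner_add_left, inner_smul_left, inner_smul_left,
        hV₀q _ (heV i) 3 (by decide), hV₂q _ (hfV i) 3 (by decide), hqq _ _ _ _ (by decide)]
      simp
  have hkx : ∀ i, (k₃ * k₂ * k₁) (x i) = q (4 * i + (1 : Fin 4)) := fun i => by
    simp only [LinearIsometryEquiv.coe_mul, Function.comp_apply]
    rw [hxab, map_add, hk₁, hk₁A _ (hbA i), map_add, hk₂, hk₂A _ (A.smul_mem _ (heA i)), hk₃]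
  have h1 : L k₁ ≤ C 2 := hC 2 _ fun n => hk₁A _ (hmemA2 n)
  have h2 : L k₂ ≤ C 0 := hC 0 _ fun n => hk₂A _ (hmemA 0 (by decide) (by decide) n)
  have h3 : L k₃ ≤ C 3 := hC 3 _ hk₃q
  have h4 : L ((k₃ * k₂ * k₁) * g * (k₃ * k₂ * k₁)⁻¹) ≤ C 1 := hC 1 _ fun n => by
    have h5 : (k₃ * k₂ * k₁)⁻¹ (q (4 * n + (1 : Fin 4))) = x n := by
      rw [← hkx]
      exact (k₃ * k₂ * k₁).symm_apply_apply (x n)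
    rw [LinearIsometryEquiv.coe_mul, LinearIsometryEquiv.coe_mul (k₃ * k₂ * k₁) g,
      Function.comp_apply, Function.comp_apply, h5, hgV _ (hxV n), hkx]
  linarith [hL.le_conj (k₃ * k₂ * k₁) g, hL.mul_le (k₃ * k₂) k₁, hL.mul_le k₃ k₂]

/-- Length functions on the orthogonal group of a separable infinite-dimensional Hilbert space are
bounded. -/
theorem IsLength.bounded [TopologicalSpace.SeparableSpace E]
    (hinf : ¬ FiniteDimensional ℝ E) {L : (E ≃ₗᵢ[ℝ] E) → ℝ} (hL : IsLength L) :
    ∃ C, ∀ g, L g ≤ C := by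
  obtain ⟨C, hC⟩ := hL.bounded_on_fixing_uniform hinf
  refine ⟨2 * C, fun g => ?_⟩
  have htop : ¬ FiniteDimensional ℝ (⊤ : Submodule ℝ E) := fun h =>
    hinf (Submodule.topEquiv.finiteDimensional (V := (⊤ : Submodule ℝ E)))
  let r : E → E → Prop := fun x y => inner ℝ x y = 0 ∧ inner ℝ (g x) y = 0 ∧ inner ℝ x (g y) = 0
  have hr : Std.Symm r := ⟨fun x y ⟨h1, h2, h3⟩ => by
    rw [real_inner_comm] at h1 h2 h3
    exact ⟨h1, h3, h2⟩⟩
  obtain ⟨x, hx1, hxr⟩ := exists_seq_of_forall_finset_exists' (fun x : E => ‖x‖ = 1) r <| by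
    classical
    intro S _
    obtain ⟨y, -, hy1, hy⟩ := exists_unit_mem_orthogonal htop
      (S ∪ S.image g ∪ S.image g.symm)
    refine ⟨y, hy1, fun x hx => ⟨hy _ ?_, hy _ ?_, ?_⟩⟩
    · simp [hx]
    · simp only [Finset.mem_union]
      exact Or.inl (Or.inr (Finset.mem_image_of_mem _ hx))
    · rw [← g.symm.inner_map_map, g.symm_apply_apply]
      refine hy _ ?_
      simp only [Finset.mem_union]
      exact Or.inr (Finset.mem_image_of_mem _ hx)
  have hx : Orthonormal ℝ x := ⟨hx1, fun i j h => (hxr h).1⟩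
  obtain ⟨k, hk, hk'⟩ := exists_isometry_exchange (u := fun i => g (x (2 * i)))
    (v := fun i => x (2 * i)) (fun i => g.norm_map _)
    (fun i j h => by rw [g.inner_map_map]; exact hx.2 (by omega))
    (fun i j h => (hxr (show 2 * i ≠ 2 * j by omega)).2.1)
    (fun i j h => hx.2 (by omega))
  have h1 : L k ≤ C := hC (fun i => x (2 * i + 1)) (hx.comp _ fun i j h => by
    simpa using h) k fun i => hk' _ fun j => by
      rw [inner_sub_left, (hxr (show 2 * j ≠ 2 * i + 1 by omega)).2.1,
        (hxr (show 2 * j ≠ 2 * i + 1 by omega)).1, sub_zero]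
  have h2 : L (k * g) ≤ C := hC (fun i => x (2 * i)) (hx.comp _ fun i j h => by
    simpa using h) _ hk
  have h3 := hL.mul_le k⁻¹ (k * g)
  rw [inv_mul_cancel_left, hL.inv_eq] at h3
  linarith

end factorization

section minkowski

variable {H}

lemma minkB_comm (v w : ℝ × H) : minkB H v w = minkB H w v := by
  simp only [minkB, real_inner_comm, mul_comm]

lemma minkB_add_left (u v w : ℝ × H) : minkB H (u + v) w = minkB H u w + minkB H v w := by
  simp only [minkB, Prod.fst_add, Prod.snd_add, inner_add_left]; ring

lemma minkB_sub_left (u v w : ℝ × H) : minkB H (u - v) w = minkB H u w - minkB H v w := by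
  simp only [minkB, Prod.fst_sub, Prod.snd_sub, inner_sub_left]; ring

lemma minkB_smul_left (c : ℝ) (v w : ℝ × H) : minkB H (c • v) w = c * minkB H v w := by
  simp only [minkB, Prod.smul_fst, Prod.smul_snd, real_inner_smul_left, smul_eq_mul]; ring

lemma minkB_sub_right (u v w : ℝ × H) : minkB H u (v - w) = minkB H u v - minkB H u w := by
  simp only [minkB_comm u, minkB_sub_left]

lemma minkB_smul_right (c : ℝ) (v w : ℝ × H) : minkB H v (c • w) = c * minkB H v w := by
  simp only [minkB_comm v, minkB_smul_left]

lemma minkB_self (v : ℝ × H) : minkB H v v = v.1 ^ 2 - ‖v.2‖ ^ 2 := by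
  rw [minkB, real_inner_self_eq_norm_sq, sq v.1]

lemma minkB_sub_self (v w : ℝ × H) :
    minkB H (v - w) (v - w) = minkB H v v + minkB H w w - 2 * minkB H v w := by
  rw [minkB_sub_left, minkB_sub_right, minkB_sub_right, minkB_comm w v]; ring

lemma continuous_minkB : Continuous fun v : (ℝ × H) × (ℝ × H) => minkB H v.1 v.2 := by
  unfold minkB; fun_prop

lemma abs_minkB_le (v w : ℝ × H) : |minkB H v w| ≤ 2 * (‖v‖ * ‖w‖) := by
  have h1 : |v.1 * w.1| ≤ ‖v‖ * ‖w‖ := by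
    rw [abs_mul]
    exact mul_le_mul (norm_fst_le v) (norm_fst_le w) (abs_nonneg _) (norm_nonneg _)
  have h2 : |inner ℝ v.2 w.2| ≤ ‖v‖ * ‖w‖ := (abs_real_inner_le_norm _ _).trans <|
    mul_le_mul (norm_snd_le v) (norm_snd_le w) (norm_nonneg _) (norm_nonneg _)
  have h3 := abs_sub (v.1 * w.1) (inner ℝ v.2 w.2)
  rw [minkB]
  linarith

/-- Vectors in the closed future cone have non-negative Minkowski product. -/
lemma minkB_nonneg {v w : ℝ × H} (hv : ‖v.2‖ ≤ v.1) (hw : ‖w.2‖ ≤ w.1) : 0 ≤ minkB H v w := by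
  have h1 := real_inner_le_norm v.2 w.2
  have h2 := mul_le_mul hv hw (norm_nonneg _) ((norm_nonneg _).trans hv)
  rw [minkB]
  linarith

lemma mem_Hyp_iff {v : ℝ × H} : v ∈ Hyp H ↔ v.1 ^ 2 = 1 + ‖v.2‖ ^ 2 ∧ 0 < v.1 := by
  rw [Hyp, Set.mem_ofPred_eq, minkB_self, sub_eq_iff_eq_add]

lemma norm_snd_lt_of_mem_Hyp {v : ℝ × H} (hv : v ∈ Hyp H) : ‖v.2‖ < v.1 := by
  rw [mem_Hyp_iff] at hv
  exact lt_of_pow_lt_pow_left₀ 2 hv.2.le (by linarith)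

lemma one_le_fst_of_mem_Hyp {v : ℝ × H} (hv : v ∈ Hyp H) : 1 ≤ v.1 := by
  rw [mem_Hyp_iff] at hv
  nlinarith [sq_nonneg ‖v.2‖]

/-- Reverse Cauchy–Schwarz inequality on the hyperboloid. -/
lemma one_lt_minkB {x y : ℝ × H} (hx : x ∈ Hyp H) (hy : y ∈ Hyp H) (hxy : x ≠ y) :
    1 < minkB H x y := by
  have hpos := minkB_nonneg (norm_snd_lt_of_mem_Hyp hx).le (norm_snd_lt_of_mem_Hyp hy).le
  rw [mem_Hyp_iff] at hx hy
  have hne : x.2 ≠ y.2 := fun h => hxy <| Prod.ext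
    ((sq_eq_sq₀ hx.2.le hy.2.le).1 (by rw [hx.1, hy.1, h])) h
  have h1 : 0 < ‖x.2 - y.2‖ ^ 2 := by have := sub_ne_zero.2 hne; positivity
  rw [norm_sub_sq_real] at h1
  have h2 := abs_real_inner_le_norm x.2 y.2
  have h3 : inner ℝ x.2 y.2 ^ 2 ≤ (‖x.2‖ * ‖y.2‖) ^ 2 := by
    rw [← sq_abs]; gcongr
  have h4 : (1 + inner ℝ x.2 y.2) ^ 2 < (x.1 * y.1) ^ 2 := by
    rw [mul_pow, hx.1, hy.1]; nlinarith
  have h5 := abs_lt_of_sq_lt_sq h4 (mul_pos hx.2 hy.2).le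
  rw [minkB]
  linarith [le_abs_self (1 + inner ℝ x.2 y.2)]

/-- The base point of the hyperboloid. -/
def hypOrigin : ℝ × H := (1, 0)

lemma minkB_hypOrigin (v : ℝ × H) : minkB H v hypOrigin = v.1 := by
  simp [minkB, hypOrigin]

lemma hypOrigin_mem : (hypOrigin : ℝ × H) ∈ Hyp H := by
  simp [mem_Hyp_iff, hypOrigin]

lemma Oplus.minkB_map (g : Oplus H) (v w : ℝ × H) : minkB H (g.1 v) (g.1 w) = minkB H v w :=
  g.2.1 v w

lemma Oplus.map_mem_Hyp (g : Oplus H) {v : ℝ × H} (hv : v ∈ Hyp H) : g.1 v ∈ Hyp H :=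
  (g.2.2 v).1 hv

lemma Oplus.mul_apply (g h : Oplus H) (v : ℝ × H) : (g * h).1 v = g.1 (h.1 v) := rfl

lemma Oplus.one_apply (v : ℝ × H) : (1 : Oplus H).1 v = v := rfl

lemma Oplus.inv_apply_self (g : Oplus H) (v : ℝ × H) : g⁻¹.1 (g.1 v) = v :=
  g.1.symm_apply_apply v

lemma Oplus.apply_inv_self (g : Oplus H) (v : ℝ × H) : g.1 (g⁻¹.1 v) = v :=
  g.1.apply_symm_apply v

lemma Oplus.minkB_map_left (g : Oplus H) (v w : ℝ × H) :
    minkB H (g.1 v) w = minkB H v (g⁻¹.1 w) := by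
  rw [← Oplus.minkB_map g v, Oplus.apply_inv_self g]

lemma Oplus.fst_map (g : Oplus H) (v : ℝ × H) :
    (g.1 v).1 = minkB H v (g⁻¹.1 hypOrigin) := by
  rw [← minkB_hypOrigin, Oplus.minkB_map_left g]

lemma Oplus.fst_inv_origin (g : Oplus H) :
    (g⁻¹.1 hypOrigin).1 = (g.1 hypOrigin).1 := by
  rw [Oplus.fst_map g, minkB_comm, minkB_hypOrigin]

lemma Oplus.fst_map_nonneg (g : Oplus H) {v : ℝ × H} (hv : ‖v.2‖ ≤ v.1) : 0 ≤ (g.1 v).1 := by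
  rw [Oplus.fst_map g]
  exact minkB_nonneg hv (norm_snd_lt_of_mem_Hyp (Oplus.map_mem_Hyp g⁻¹ hypOrigin_mem)).le

/-- The norm of a Lorentz transformation is controlled by the displacement of the base point. -/
lemma Oplus.norm_map_le (g : Oplus H) (v : ℝ × H) :
    ‖g.1 v‖ ≤ 4 * (g.1 hypOrigin).1 * ‖v‖ := by
  set τ := (g.1 hypOrigin).1
  have hτ : 1 ≤ τ := one_le_fst_of_mem_Hyp (Oplus.map_mem_Hyp g hypOrigin_mem)
  have h1 : |v.1| ≤ ‖v‖ := norm_fst_le v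
  have h2 : ‖v.2‖ ≤ ‖v‖ := norm_snd_le v
  have h3 := abs_le.1 h1
  have h4 : 0 ≤ (g.1 ((2 * ‖v‖) • hypOrigin + v)).1 := Oplus.fst_map_nonneg g <| by
    simp only [hypOrigin, Prod.snd_add, Prod.smul_snd, smul_zero, zero_add, Prod.fst_add,
      Prod.smul_fst, smul_eq_mul, mul_one]
    linarith
  have h5 : 0 ≤ (g.1 ((2 * ‖v‖) • hypOrigin - v)).1 := Oplus.fst_map_nonneg g <| by
    simp only [hypOrigin, Prod.snd_sub, Prod.smul_snd, smul_zero, zero_sub, norm_neg, Prod.fst_sub,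
      Prod.smul_fst, smul_eq_mul, mul_one]
    linarith
  rw [map_add, map_smul, Prod.fst_add, Prod.smul_fst, smul_eq_mul] at h4
  rw [map_sub, map_smul, Prod.fst_sub, Prod.smul_fst, smul_eq_mul] at h5
  have h6 : |(g.1 v).1| ≤ 2 * ‖v‖ * τ := abs_le.2 ⟨by linarith, by linarith⟩
  have h7 := Oplus.minkB_map g v v
  rw [minkB_self, minkB_self] at h7
  have h8 : (g.1 v).1 ^ 2 ≤ (2 * ‖v‖ * τ) ^ 2 := by rw [← sq_abs]; gcongr
  have h9 : ‖v.2‖ ^ 2 ≤ (‖v‖ * τ) ^ 2 := by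
    gcongr
    nlinarith [norm_nonneg v]
  have h10 : ‖(g.1 v).2‖ ≤ 4 * τ * ‖v‖ := by
    refine (sq_le_sq₀ (norm_nonneg _) (by positivity)).1 ?_
    nlinarith [sq_nonneg v.1, sq_nonneg (‖v‖ * τ)]
  have h11 : 0 ≤ ‖v‖ * τ := by positivity
  exact norm_prod_le_iff.2 ⟨by rw [Real.norm_eq_abs]; linarith, h10⟩

lemma Oplus.fst_map_origin_le (g : Oplus H) {p : ℝ × H} (hp : ‖p.2‖ < p.1) :
    (g.1 hypOrigin).1 ≤ (g.1 p).1 / (p.1 - ‖p.2‖) := by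
  rw [le_div_iff₀ (by linarith)]
  have h : 0 ≤ (g.1 (p - (p.1 - ‖p.2‖) • hypOrigin)).1 := Oplus.fst_map_nonneg g <| by
    simp [hypOrigin]
  rw [map_sub, map_smul, Prod.fst_sub, Prod.smul_fst, smul_eq_mul] at h
  linarith

lemma Oplus.isLength_log : IsLength fun g : Oplus H => Real.log (2 * (g.1 hypOrigin).1) where
  mul_le g h := by
    have hg := norm_snd_lt_of_mem_Hyp (Oplus.map_mem_Hyp g⁻¹ hypOrigin_mem)
    have hh := norm_snd_lt_of_mem_Hyp (Oplus.map_mem_Hyp h hypOrigin_mem)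
    have hg1 := one_le_fst_of_mem_Hyp (Oplus.map_mem_Hyp g hypOrigin_mem)
    have hh1 := one_le_fst_of_mem_Hyp (Oplus.map_mem_Hyp h hypOrigin_mem)
    have hgh1 := one_le_fst_of_mem_Hyp (Oplus.map_mem_Hyp (g * h) hypOrigin_mem)
    rw [← Real.log_mul (by positivity) (by positivity)]
    refine Real.log_le_log (by positivity) ?_
    have h1 := (abs_le.1 (abs_real_inner_le_norm (h.1 hypOrigin).2 (g⁻¹.1 hypOrigin).2)).1
    have h2 := mul_le_mul hh.le hg.le (norm_nonneg _) (by positivity)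
    rw [Oplus.fst_inv_origin g] at h2
    rw [Oplus.mul_apply, Oplus.fst_map, minkB, Oplus.fst_inv_origin g]
    linarith
  inv_eq g := by rw [Oplus.fst_inv_origin g]

end minkowski

section transitivity

variable {H}

/-- A linear automorphism preserving the Minkowski form and mapping one point of the hyperboloid
into the hyperboloid belongs to `O₊(B)`. -/
lemma mem_Oplus_of_map_mem {g : (ℝ × H) ≃L[ℝ] (ℝ × H)}
    (hB : ∀ v w, minkB H (g v) (g w) = minkB H v w) {x : ℝ × H} (hx : x ∈ Hyp H)
    (hgx : g x ∈ Hyp H) : g ∈ Oplus H := by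
  have key : ∀ f : (ℝ × H) ≃L[ℝ] (ℝ × H), (∀ v w, minkB H (f v) (f w) = minkB H v w) →
      ∀ y ∈ Hyp H, f y ∈ Hyp H → ∀ v ∈ Hyp H, f v ∈ Hyp H := by
    intro f hf y hy hfy v hv
    have h1 : minkB H (f v) (f v) = 1 := (hf v v).trans hv.1
    refine ⟨h1, ?_⟩
    by_contra hneg
    rw [minkB_self] at h1
    have h2 : ‖(f v).2‖ < |(f v).1| := by
      refine lt_of_pow_lt_pow_left₀ 2 (abs_nonneg _) ?_
      rw [sq_abs]; linarith
    rw [abs_of_nonpos (not_lt.1 hneg)] at h2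
    have h3 : 0 ≤ minkB H ((-1 : ℝ) • f v) (f y) :=
      minkB_nonneg (by simpa using h2.le) (norm_snd_lt_of_mem_Hyp hfy).le
    rw [minkB_smul_left, hf] at h3
    rcases eq_or_ne v y with rfl | hvy
    · linarith [hv.1]
    · linarith [one_lt_minkB hv hy hvy]
  refine ⟨hB, fun v => ⟨key g hB x hx hgx v, fun hv => ?_⟩⟩
  have h := key g.symm (fun v w => by
    rw [← hB, g.apply_symm_apply, g.apply_symm_apply]) (g x) hgx (by simpa using hx) _ hv
  simpa using h

/-- The Minkowski form as a continuous functional of the first argument. -/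
noncomputable def minkBL (w : ℝ × H) : (ℝ × H) →L[ℝ] ℝ :=
  w.1 • ContinuousLinearMap.fst ℝ ℝ H - (innerSL ℝ w.2).comp (ContinuousLinearMap.snd ℝ ℝ H)

lemma minkBL_apply (w v : ℝ × H) : minkBL w v = minkB H v w := by
  rw [minkB_comm]; simp [minkBL, minkB]

/-- The linear reflection of Minkowski space in the orthogonal complement of `w`. -/
noncomputable def minkReflectionL (w : ℝ × H) : (ℝ × H) →L[ℝ] (ℝ × H) :=
  ContinuousLinearMap.id ℝ (ℝ × H) - (2 / minkB H w w) • (minkBL w).smulRight w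

lemma minkReflectionL_apply (w v : ℝ × H) :
    minkReflectionL w v = v - (2 / minkB H w w * minkB H v w) • w := by
  simp [minkReflectionL, minkBL_apply, smul_smul]

lemma minkReflectionL_involutive {w : ℝ × H} (hw : minkB H w w ≠ 0) :
    Function.Involutive (minkReflectionL w) := by
  intro v
  rw [minkReflectionL_apply, minkReflectionL_apply, minkB_sub_left, minkB_smul_left]
  have h : 2 / minkB H w w * (minkB H v w - 2 / minkB H w w * minkB H v w * minkB H w w) =
      -(2 / minkB H w w * minkB H v w) := by
    field_simp; ring
  rw [h]
  module

/-- The reflection exchanging two points of the hyperboloid. -/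
lemma exists_Oplus_reflection {x y : ℝ × H} (hx : x ∈ Hyp H) (hy : y ∈ Hyp H) (hxy : x ≠ y) :
    ∃ r : Oplus H, r.1 x = y ∧ ∀ v, minkB H v (x - y) = 0 → r.1 v = v := by
  have hD : minkB H (x - y) (x - y) ≠ 0 := by
    rw [minkB_sub_self, hx.1, hy.1]
    linarith [one_lt_minkB hx hy hxy]
  have hinv := minkReflectionL_involutive hD
  let r := ContinuousLinearEquiv.equivOfInverse _ _ hinv hinv
  have hr : ∀ v, r v = v - (2 / minkB H (x - y) (x - y) * minkB H v (x - y)) • (x - y) :=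
    minkReflectionL_apply (x - y)
  have hrx : r x = y := by
    have h : 2 / minkB H (x - y) (x - y) * minkB H x (x - y) = 1 := by
      rw [div_mul_eq_mul_div, div_eq_one_iff_eq hD, minkB_sub_self, minkB_sub_right, hx.1, hy.1]
      ring
    rw [hr, h, one_smul, sub_sub_cancel]
  refine ⟨⟨r, mem_Oplus_of_map_mem (fun v w => ?_) hx (hrx ▸ hy)⟩, hrx, fun v hv => ?_⟩
  · rw [hr, hr]
    generalize x - y = z at hD
    simp only [minkB_sub_left, minkB_sub_right, minkB_smul_left, minkB_smul_right, minkB_comm z w]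
    field_simp
    ring
  · change r v = v
    rw [hr, hv, mul_zero, zero_smul, sub_zero]

/-- Transitivity of `O₊(B)` on the hyperboloid. -/
lemma exists_Oplus_map_origin {y : ℝ × H} (hy : y ∈ Hyp H) :
    ∃ g : Oplus H, g.1 hypOrigin = y := by
  rcases eq_or_ne hypOrigin y with h | h
  · exact ⟨1, h⟩
  · obtain ⟨r, hr, -⟩ := exists_Oplus_reflection hypOrigin_mem hy h
    exact ⟨r, hr⟩

/-- Transitivity of the stabilizer of the base point on spheres. -/
lemma exists_Oplus_fixing_origin {x y : ℝ × H} (hx : x ∈ Hyp H) (hy : y ∈ Hyp H)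
    (hxy : x.1 = y.1) : ∃ g : Oplus H, g.1 hypOrigin = hypOrigin ∧ g.1 x = y := by
  rcases eq_or_ne x y with h | h
  · exact ⟨1, rfl, h⟩
  · obtain ⟨r, hr, hr'⟩ := exists_Oplus_reflection hx hy h
    refine ⟨r, hr' _ ?_, hr⟩
    rw [minkB_comm, minkB_hypOrigin, Prod.fst_sub, hxy, sub_self]

/-- The stabilizer of the base point as the image of the orthogonal group. -/
noncomputable def isometryToOplus : (H ≃ₗᵢ[ℝ] H) →* Oplus H where
  toFun k := ⟨(ContinuousLinearEquiv.refl ℝ ℝ).prodCongr k.toContinuousLinearEquiv,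
    mem_Oplus_of_map_mem (fun v w => by simp [minkB]) hypOrigin_mem (by
      simpa [hypOrigin] using hypOrigin_mem)⟩
  map_one' := rfl
  map_mul' _ _ := rfl

lemma exists_isometryToOplus_eq {g : Oplus H} (hg : g.1 hypOrigin = hypOrigin) :
    ∃ k : H ≃ₗᵢ[ℝ] H, isometryToOplus k = g := by
  have hg' : g⁻¹.1 hypOrigin = hypOrigin := by
    conv_lhs => rw [← hg]
    exact Oplus.inv_apply_self g _
  have h1 : ∀ v, (g.1 v).1 = v.1 := fun v => by rw [Oplus.fst_map, hg', minkB_hypOrigin]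
  have h2 : ∀ v, (g⁻¹.1 v).1 = v.1 := fun v => by
    rw [Oplus.fst_map, inv_inv, hg, minkB_hypOrigin]
  have e1 : ∀ h : H, (0, (g.1 (0, h)).2) = g.1 (0, h) := fun h => Prod.ext (h1 (0, h)).symm rfl
  have e2 : ∀ h : H, (0, (g⁻¹.1 (0, h)).2) = g⁻¹.1 (0, h) := fun h => Prod.ext (h2 (0, h)).symm rfl
  let f : H →ₗ[ℝ] H := (LinearMap.snd ℝ ℝ H).comp
    ((g.1.toLinearEquiv : (ℝ × H) →ₗ[ℝ] (ℝ × H)).comp (LinearMap.inr ℝ ℝ H))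
  let f' : H →ₗ[ℝ] H := (LinearMap.snd ℝ ℝ H).comp
    ((g⁻¹.1.toLinearEquiv : (ℝ × H) →ₗ[ℝ] (ℝ × H)).comp (LinearMap.inr ℝ ℝ H))
  have hf : ∀ h, f h = (g.1 (0, h)).2 := fun h => rfl
  have hf' : ∀ h, f' h = (g⁻¹.1 (0, h)).2 := fun h => rfl
  let k : H ≃ₗᵢ[ℝ] H :=
    ⟨LinearEquiv.ofLinearMap f f' (LinearMap.ext fun h => by
        rw [LinearMap.comp_apply, hf, hf', e2, Oplus.apply_inv_self]; rfl)
      (LinearMap.ext fun h => by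
        rw [LinearMap.comp_apply, hf, hf', e1, Oplus.inv_apply_self]; rfl), fun h => by
      have h3 := Oplus.minkB_map g (0, h) (0, h)
      rw [minkB_self, minkB_self, h1] at h3
      refine (sq_eq_sq₀ (norm_nonneg _) (norm_nonneg _)).1 ?_
      change ‖(g.1 (0, h)).2‖ ^ 2 = ‖h‖ ^ 2
      dsimp only at h3
      linarith⟩
  refine ⟨k, Subtype.ext (ContinuousLinearEquiv.ext (funext fun v => ?_))⟩
  change (v.1, (g.1 (0, v.2)).2) = g.1 v
  refine Prod.ext (h1 v).symm ?_
  have h4 : v = v.1 • hypOrigin + (0, v.2) := by ext <;> simp [hypOrigin]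
  conv_rhs => rw [h4, map_add, map_smul, hg]
  simp [hypOrigin]

end transitivity

section fixedPoint

variable {H}

/-- The Hilbertian square norm on Minkowski space. -/
def hilbSq (v : ℝ × H) : ℝ := v.1 ^ 2 + ‖v.2‖ ^ 2

lemma sq_norm_le_hilbSq (v : ℝ × H) : ‖v‖ ^ 2 ≤ hilbSq v := by
  rw [Prod.norm_def, hilbSq]
  rcases max_choice ‖v.1‖ ‖v.2‖ with h | h <;> rw [h]
  · rw [Real.norm_eq_abs, sq_abs]; linarith [sq_nonneg ‖v.2‖]
  · linarith [sq_nonneg v.1]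

lemma hilbSq_le (v : ℝ × H) : hilbSq v ≤ 2 * ‖v‖ ^ 2 := by
  have h1 : v.1 ^ 2 ≤ ‖v‖ ^ 2 := by rw [← sq_abs]; gcongr; exact norm_fst_le v
  have h2 : ‖v.2‖ ^ 2 ≤ ‖v‖ ^ 2 := by gcongr; exact norm_snd_le v
  rw [hilbSq]
  linarith

lemma continuous_hilbSq : Continuous (hilbSq : ℝ × H → ℝ) := by
  unfold hilbSq; fun_prop

lemma hilbSq_midpoint (v w : ℝ × H) :
    hilbSq ((2⁻¹ : ℝ) • (v + w)) = (hilbSq v + hilbSq w) / 2 - hilbSq (v - w) / 4 := by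
  have h := parallelogram_law_with_norm ℝ v.2 w.2
  simp only [hilbSq, Prod.smul_fst, Prod.smul_snd, Prod.fst_add, Prod.snd_add, Prod.fst_sub,
    Prod.snd_sub, smul_eq_mul, norm_smul, norm_inv, Real.norm_ofNat]
  linear_combination h / 4

variable (H) in
/-- The convex hull of the hyperboloid. -/
def solidHyp : Set (ℝ × H) := {v | 0 ≤ v.1 ∧ 1 + ‖v.2‖ ^ 2 ≤ v.1 ^ 2}

lemma isClosed_solidHyp : IsClosed (solidHyp H) :=
  (isClosed_le continuous_const continuous_fst).inter
    (isClosed_le (f := fun v : ℝ × H => 1 + ‖v.2‖ ^ 2) (g := fun v => v.1 ^ 2) (by fun_prop)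
      (by fun_prop))

lemma norm_snd_lt_of_mem_solidHyp {v : ℝ × H} (hv : v ∈ solidHyp H) : ‖v.2‖ < v.1 :=
  lt_of_pow_lt_pow_left₀ 2 hv.1 (by linarith [hv.2])

lemma midpoint_mem_solidHyp {v w : ℝ × H} (hv : v ∈ solidHyp H) (hw : w ∈ solidHyp H) :
    (2⁻¹ : ℝ) • (v + w) ∈ solidHyp H := by
  obtain ⟨hv1, hv2⟩ := hv
  obtain ⟨hw1, hw2⟩ := hw
  have h1 : (1 + ‖v.2‖ * ‖w.2‖) ^ 2 ≤ (v.1 * w.1) ^ 2 := by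
    rw [mul_pow]
    refine le_trans ?_ (mul_le_mul hv2 hw2 (by positivity) (by positivity))
    nlinarith [sq_nonneg (‖v.2‖ - ‖w.2‖)]
  have h2 : 1 + ‖v.2‖ * ‖w.2‖ ≤ v.1 * w.1 := (sq_le_sq₀ (by positivity) (by positivity)).1 h1
  have h3 : ‖v.2 + w.2‖ ^ 2 ≤ (‖v.2‖ + ‖w.2‖) ^ 2 := by gcongr; exact norm_add_le _ _
  refine ⟨by simp; positivity, ?_⟩
  simp only [Prod.smul_fst, Prod.smul_snd, Prod.fst_add, Prod.snd_add, smul_eq_mul, norm_smul,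
    norm_inv, Real.norm_ofNat]
  linarith

lemma Oplus.map_mem_solidHyp (g : Oplus H) {v : ℝ × H} (hv : v ∈ solidHyp H) :
    g.1 v ∈ solidHyp H := by
  refine ⟨Oplus.fst_map_nonneg g (norm_snd_lt_of_mem_solidHyp hv).le, ?_⟩
  have h := Oplus.minkB_map g v v
  rw [minkB_self, minkB_self] at h
  linarith [hv.2]

/-- A group of Lorentz transformations with uniformly bounded norms fixes a vector inside the
future cone. -/
lemma exists_fixed_of_bounded [CompleteSpace H] {K : Type*} [Group K] (σ : K →* Oplus H) {M : ℝ}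
    (hM : ∀ k v, ‖(σ k).1 v‖ ≤ M * ‖v‖) :
    ∃ p : ℝ × H, p ∈ solidHyp H ∧ ∀ k, (σ k).1 p = p := by
  have hM0 : 0 < M := by
    have h := hM 1 hypOrigin
    rw [map_one, Oplus.one_apply] at h
    have h1 : 0 < ‖(hypOrigin : ℝ × H)‖ := norm_pos_iff.2 fun h => by simp [hypOrigin] at h
    nlinarith
  let F : ℝ × H → ℝ := fun v => ⨆ k, hilbSq ((σ k).1 v)
  have hbdd : ∀ v, BddAbove (Set.range fun k => hilbSq ((σ k).1 v)) := fun v =>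
    ⟨2 * (M * ‖v‖) ^ 2, by
      rintro _ ⟨k, rfl⟩
      refine (hilbSq_le _).trans ?_
      have := hM k v
      gcongr⟩
  have hle : ∀ k v, hilbSq ((σ k).1 v) ≤ F v := fun k v => le_ciSup (hbdd v) k
  have hF0 : ∀ v, 0 ≤ F v := fun v => le_trans (by unfold hilbSq; positivity) (hle 1 v)
  have hFinv : ∀ k v, F ((σ k).1 v) ≤ F v := fun k v => ciSup_le fun l => by
    rw [← Oplus.mul_apply, ← map_mul]
    exact hle _ _
  have hlow : ∀ k v, ‖v‖ ^ 2 / M ^ 2 ≤ hilbSq ((σ k).1 v) := fun k v => by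
    refine le_trans ?_ (sq_norm_le_hilbSq _)
    rw [div_le_iff₀ (by positivity), ← mul_pow, mul_comm]
    gcongr
    have h := hM k⁻¹ ((σ k).1 v)
    rwa [← Oplus.mul_apply, ← map_mul, inv_mul_cancel, map_one, Oplus.one_apply] at h
  have hmid : ∀ v w, F ((2⁻¹ : ℝ) • (v + w)) ≤ (F v + F w) / 2 - ‖v - w‖ ^ 2 / M ^ 2 / 4 :=
    fun v w => ciSup_le fun k => by
      rw [map_smul, map_add, hilbSq_midpoint, ← map_sub]
      linarith [hle k v, hle k w, hlow k (v - w)]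
  set I := sInf (F '' solidHyp H)
  have hI : ∀ v ∈ solidHyp H, I ≤ F v := fun v hv =>
    csInf_le ⟨0, by rintro _ ⟨w, -, rfl⟩; exact hF0 w⟩ ⟨v, hv, rfl⟩
  have hdist : ∀ v ∈ solidHyp H, ∀ w ∈ solidHyp H,
      ‖v - w‖ ^ 2 ≤ 2 * M ^ 2 * ((F v - I) + (F w - I)) := fun v hv w hw => by
    have h1 := (hI _ (midpoint_mem_solidHyp hv hw)).trans (hmid v w)
    have h2 : ‖v - w‖ ^ 2 / M ^ 2 ≤ 2 * ((F v - I) + (F w - I)) := by linarith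
    rw [div_le_iff₀ (by positivity)] at h2
    linarith
  have hseq : ∀ n : ℕ, ∃ v ∈ solidHyp H, F v < I + 1 / (n + 1) := fun n => by
    obtain ⟨_, ⟨v, hv, rfl⟩, h⟩ := exists_lt_of_csInf_lt
      (s := F '' solidHyp H) ⟨_, hypOrigin, by simp [solidHyp, hypOrigin], rfl⟩
      (show I < I + 1 / ((n : ℝ) + 1) by linarith [Nat.one_div_pos_of_nat (α := ℝ) (n := n)])
    exact ⟨v, hv, h⟩
  choose v hv hvF using hseq
  have hFlim : Filter.Tendsto (fun n => F (v n)) Filter.atTop (nhds I) := by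
    have h := (tendsto_one_div_add_atTop_nhds_zero_nat (𝕜 := ℝ)).const_add I
    rw [add_zero] at h
    exact tendsto_of_tendsto_of_tendsto_of_le_of_le tendsto_const_nhds h
      (fun n => hI _ (hv n)) fun n => (hvF n).le
  have hcauchy : CauchySeq v := by
    rw [Metric.cauchySeq_iff]
    intro ε hε
    have hev := hFlim.eventually_lt_const
      (show I < I + ε ^ 2 / (4 * M ^ 2) from lt_add_of_pos_right _ (by positivity))
    obtain ⟨N, hN⟩ := Filter.eventually_atTop.1 hev
    refine ⟨N, fun m hm n hn => ?_⟩
    rw [dist_eq_norm]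
    refine lt_of_pow_lt_pow_left₀ 2 hε.le ?_
    have h1 := hdist _ (hv m) _ (hv n)
    have h2 : F (v m) - I + (F (v n) - I) < 2 * (ε ^ 2 / (4 * M ^ 2)) := by
      linarith [hN m hm, hN n hn]
    calc ‖v m - v n‖ ^ 2 ≤ _ := h1
      _ < 2 * M ^ 2 * (2 * (ε ^ 2 / (4 * M ^ 2))) := by gcongr
      _ = ε ^ 2 := by field_simp; ring
  obtain ⟨p, hp⟩ := cauchySeq_tendsto_of_complete hcauchy
  have hpS : p ∈ solidHyp H := isClosed_solidHyp.mem_of_tendsto hp (Filter.Eventually.of_forall hv)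
  have hpF : F p ≤ I := ciSup_le fun k => by
    have h1 : Filter.Tendsto (fun n => hilbSq ((σ k).1 (v n))) Filter.atTop
        (nhds (hilbSq ((σ k).1 p))) :=
      ((continuous_hilbSq.comp (σ k).1.continuous).tendsto p).comp hp
    exact le_of_tendsto_of_tendsto' h1 hFlim fun n => hle k _
  refine ⟨p, hpS, fun k => ?_⟩
  have h := hdist _ (Oplus.map_mem_solidHyp (σ k) hpS) _ hpS
  have h2 : ‖(σ k).1 p - p‖ ^ 2 ≤ 0 := h.trans <|
    mul_nonpos_of_nonneg_of_nonpos (by positivity) (by linarith [hFinv k p])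
  exact sub_eq_zero.1 (norm_eq_zero.1 ((pow_eq_zero_iff two_ne_zero).1
    (h2.antisymm (by positivity))))

end fixedPoint

section continuity

variable {H}

/-- On the quadric through `p`, the Minkowski product with `p` controls the distance to `p`. -/
lemma exists_forall_norm_sub_lt {p : ℝ × H} (hp : ‖p.2‖ < p.1) {η : ℝ} (hη : 0 < η) :
    ∃ ε > 0, ∀ y : ℝ × H, minkB H y y = minkB H p p → |minkB H y p - minkB H p p| < ε →
      ‖y - p‖ < η := by
  have hp0 : 0 < p.1 := (norm_nonneg _).trans_lt hp
  have hδ : 0 < p.1 - ‖p.2‖ := sub_pos.2 hp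
  set A := (1 + p.1) / (p.1 - ‖p.2‖) + 1
  have hA : 0 < A := by positivity
  set s := min 1 (η / (2 * A))
  have hs0 : 0 < s := by positivity
  have hs1 : s ≤ 1 := min_le_left _ _
  have hsA : A * s ≤ η / 2 := by
    calc A * s ≤ A * (η / (2 * A)) := by gcongr; exact min_le_right _ _
      _ = η / 2 := by field_simp
  refine ⟨s ^ 2 / 2, by positivity, fun y hy hyp => ?_⟩
  obtain ⟨hN1, hN2⟩ := abs_lt.1 hyp
  have hdd := minkB_sub_self y p
  have hdp := minkB_sub_left y p p
  generalize y - p = d at hdd hdp ⊢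
  rw [hy, minkB_self d] at hdd
  rw [minkB] at hdp
  have h1 : ‖d.2‖ ≤ |d.1| + s := by
    refine (sq_le_sq₀ (norm_nonneg _) (by positivity)).1 ?_
    have := sq_abs d.1
    nlinarith [mul_nonneg (abs_nonneg d.1) hs0.le]
  have h2 : |d.1| ≤ ‖d.2‖ + s := by
    refine (sq_le_sq₀ (abs_nonneg _) (by positivity)).1 ?_
    have := sq_abs d.1
    nlinarith [mul_nonneg (norm_nonneg d.2) hs0.le]
  have h3 : p.1 * |d.1| ≤ s ^ 2 / 2 + ‖d.2‖ * ‖p.2‖ := by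
    have h4 := abs_le.1 (abs_real_inner_le_norm d.2 p.2)
    rw [← abs_of_pos hp0, ← abs_mul, mul_comm, abs_le]
    constructor <;> linarith
  have h5 : ‖d.2‖ * (p.1 - ‖p.2‖) ≤ (1 + p.1) * s := by nlinarith
  have h6 : ‖d.2‖ ≤ (1 + p.1) / (p.1 - ‖p.2‖) * s := by
    rwa [div_mul_eq_mul_div, le_div_iff₀ hδ]
  have h7 : ‖d.2‖ + s ≤ A * s := by rw [add_mul, one_mul]; linarith
  exact (norm_prod_le_iff.2 ⟨by rw [Real.norm_eq_abs]; linarith, by linarith⟩ :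
    ‖d‖ ≤ η / 2).trans_lt (by linarith)

/-- Existence of isosceles triangles with prescribed sides. -/
lemma exists_isosceles (hinf : ¬ FiniteDimensional ℝ H) {y : ℝ × H} (hy : y ∈ Hyp H) {c : ℝ}
    (hyc : y.1 ≤ c) : ∃ z ∈ Hyp H, z.1 = c ∧ minkB H z y = c := by
  have hy1 := one_le_fst_of_mem_Hyp hy
  obtain ⟨e, -, he1, he⟩ := exists_unit_mem_orthogonal (V := (⊤ : Submodule ℝ H))
    (fun h => hinf (Submodule.topEquiv.finiteDimensional (V := (⊤ : Submodule ℝ H)))) {y.2}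
  have hye := he y.2 (Finset.mem_singleton_self _)
  rw [mem_Hyp_iff] at hy
  have hyn : ‖y.2‖ ^ 2 = y.1 ^ 2 - 1 := by linarith [hy.1]
  set α := c / (y.1 + 1)
  have hα : α * (y.1 + 1) = c := div_mul_cancel₀ _ (by positivity)
  have hα2 : 0 ≤ c ^ 2 - 1 - α ^ 2 * ‖y.2‖ ^ 2 := by
    have h1 : c ^ 2 - 1 - α ^ 2 * ‖y.2‖ ^ 2 = 2 * c * α - 1 := by
      rw [hyn, ← hα]; ring
    have h2 : (1 : ℝ) / 2 ≤ α := by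
      rw [div_le_div_iff₀ (by norm_num) (by positivity)]; linarith
    rw [h1]
    nlinarith
  have hin : inner ℝ (α • y.2) (√(c ^ 2 - 1 - α ^ 2 * ‖y.2‖ ^ 2) • e) = 0 := by
    rw [inner_smul_left, inner_smul_right, hye, mul_zero, mul_zero]
  refine ⟨(c, α • y.2 + √(c ^ 2 - 1 - α ^ 2 * ‖y.2‖ ^ 2) • e), ?_, rfl, ?_⟩
  · refine mem_Hyp_iff.2 ⟨?_, by dsimp only; linarith⟩
    rw [norm_add_sq_real, hin, norm_smul, norm_smul, he1, mul_pow, mul_pow, Real.norm_eq_abs,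
      Real.norm_eq_abs, sq_abs, sq_abs, Real.sq_sqrt hα2]
    ring
  · rw [minkB, inner_add_left, real_inner_smul_left, real_inner_smul_left, real_inner_comm y.2 e,
      hye, real_inner_self_eq_norm_sq, hyn]
    linear_combination (y.1 - 1) * (-hα)

/-- The stabilizer of the base point has a fixed vector inside the future cone in every
representation. -/
lemma exists_fixed_by_stabilizer [CompleteSpace H] [TopologicalSpace.SeparableSpace H]
    (hinf : ¬ FiniteDimensional ℝ H) (ρ : Oplus H →* Oplus H) :
    ∃ p : ℝ × H, p ∈ solidHyp H ∧
      ∀ g : Oplus H, g.1 hypOrigin = hypOrigin → (ρ g).1 p = p := by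
  obtain ⟨C, hC⟩ := (Oplus.isLength_log.comp (ρ.comp isometryToOplus)).bounded hinf
  obtain ⟨p, hpS, hp⟩ := exists_fixed_of_bounded (ρ.comp isometryToOplus) (M := 2 * Real.exp C)
    fun k v => by
      refine (Oplus.norm_map_le _ v).trans ?_
      have h1 := one_le_fst_of_mem_Hyp
        (Oplus.map_mem_Hyp (ρ.comp isometryToOplus k) hypOrigin_mem)
      have h2 := (Real.log_le_iff_le_exp (by positivity)).1 (hC k)
      exact mul_le_mul_of_nonneg_right (by linarith) (norm_nonneg v)
  refine ⟨p, hpS, fun g hg => ?_⟩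
  obtain ⟨k, rfl⟩ := exists_isometryToOplus_eq hg
  exact hp k

section displacement

variable {ρ : Oplus H →* Oplus H} {p : ℝ × H}

lemma minkB_map_eq_of_fst_eq
    (hfix : ∀ g : Oplus H, g.1 hypOrigin = hypOrigin → (ρ g).1 p = p) {g h : Oplus H}
    (hgh : (g.1 hypOrigin).1 = (h.1 hypOrigin).1) :
    minkB H ((ρ g).1 p) p = minkB H ((ρ h).1 p) p := by
  obtain ⟨k, hk, hkg⟩ := exists_Oplus_fixing_origin (Oplus.map_mem_Hyp g hypOrigin_mem)
    (Oplus.map_mem_Hyp h hypOrigin_mem) hgh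
  have h1 : (h⁻¹ * (k * g)).1 hypOrigin = hypOrigin := by
    rw [Oplus.mul_apply, Oplus.mul_apply, hkg, Oplus.inv_apply_self]
  have h2 : (ρ k).1 ((ρ g).1 p) = (ρ h).1 p := by
    conv_rhs => rw [← hfix _ h1]
    rw [← Oplus.mul_apply, ← Oplus.mul_apply, ← map_mul, ← map_mul, mul_inv_cancel_left]
  rw [← Oplus.minkB_map (ρ k), h2, hfix k hk]

lemma minkB_map_mul (g h : Oplus H) :
    minkB H ((ρ (g * h)).1 p) p = minkB H ((ρ h).1 p) ((ρ g⁻¹).1 p) := by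
  rw [map_mul, Oplus.mul_apply, Oplus.minkB_map_left, map_inv]

lemma exists_small_displacement [TopologicalSpace.SeparableSpace H] [Nontrivial H]
    (ρ : Oplus H →* Oplus H) (p : ℝ × H) {ε : ℝ} (hε : 0 < ε) :
    ∃ g : Oplus H, 1 < (g.1 hypOrigin).1 ∧
      |minkB H ((ρ g).1 p) p - minkB H p p| < ε := by
  obtain ⟨u, hu⟩ := exists_norm_eq H (zero_le_one (α := ℝ))
  let x : ℝ → ℝ × H := fun t => (Real.cosh t, Real.sinh t • u)
  have hx : ∀ t, x t ∈ Hyp H := fun t => mem_Hyp_iff.2 ⟨by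
    simp only [x]
    rw [norm_smul, hu, mul_one, Real.norm_eq_abs, sq_abs, Real.cosh_sq, add_comm], Real.cosh_pos t⟩
  choose g hg using fun t => exists_Oplus_map_origin (hx t)
  obtain ⟨s, t, hst, hd⟩ := exists_ne_dist_lt_of_uncountable (fun t => (ρ (g t)).1 p)
    (Real.sqrt_pos.2 hε)
  rw [dist_eq_norm] at hd
  refine ⟨(g t)⁻¹ * g s, ?_, ?_⟩
  · rw [Oplus.mul_apply, Oplus.fst_map, inv_inv, hg, hg]
    refine one_lt_minkB (hx s) (hx t) fun h => hst ?_
    have h1 := congrArg Prod.snd h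
    have hu0 : u ≠ 0 := fun h => by simp [h] at hu
    exact Real.sinh_injective (smul_left_injective ℝ hu0 h1)
  · rw [minkB_map_mul, inv_inv]
    have h1 := minkB_sub_self ((ρ (g s)).1 p) ((ρ (g t)).1 p)
    rw [Oplus.minkB_map, Oplus.minkB_map] at h1
    have h2 := abs_minkB_le ((ρ (g s)).1 p - (ρ (g t)).1 p) ((ρ (g s)).1 p - (ρ (g t)).1 p)
    have h3 : ‖(ρ (g s)).1 p - (ρ (g t)).1 p‖ ^ 2 < ε := by
      rw [← Real.sq_sqrt hε.le]; gcongr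
    rw [h1, ← sq, abs_le] at h2
    rw [abs_lt]
    constructor <;> linarith

lemma exists_forall_norm_map_sub_lt [TopologicalSpace.SeparableSpace H]
    (hinf : ¬ FiniteDimensional ℝ H) (hp : ‖p.2‖ < p.1)
    (hfix : ∀ g : Oplus H, g.1 hypOrigin = hypOrigin → (ρ g).1 p = p) {η : ℝ} (hη : 0 < η) :
    ∃ c > 1, ∀ g : Oplus H, (g.1 hypOrigin).1 < c → ‖(ρ g).1 p - p‖ < η := by
  have : Nontrivial H := not_subsingleton_iff_nontrivial.1 fun _ => hinf inferInstance
  obtain ⟨ε, hε, h1⟩ := exists_forall_norm_sub_lt hp hη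
  obtain ⟨η', hη', h2⟩ := Metric.continuousAt_iff.1
    (continuous_minkB.continuousAt (x := (p, p))) ε hε
  obtain ⟨ε', hε', h3⟩ := exists_forall_norm_sub_lt hp hη'
  obtain ⟨g₁, hg₁, hg₁'⟩ := exists_small_displacement ρ p hε'
  have h4 : ∀ h : Oplus H, (h.1 hypOrigin).1 = (g₁.1 hypOrigin).1 → dist ((ρ h).1 p) p < η' :=
    fun h hh => by
      rw [dist_eq_norm]
      exact h3 _ (Oplus.minkB_map _ _ _) (by rwa [minkB_map_eq_of_fst_eq hfix hh])
  refine ⟨_, hg₁, fun g hg => h1 _ (Oplus.minkB_map _ _ _) ?_⟩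
  have hgo := Oplus.map_mem_Hyp g hypOrigin_mem
  obtain ⟨z, hz, hz1, hz2⟩ := exists_isosceles hinf hgo hg.le
  obtain ⟨k, rfl⟩ := exists_Oplus_map_origin hz
  have h5 : minkB H ((ρ g).1 p) p = minkB H ((ρ (k⁻¹ * g)).1 p) ((ρ k⁻¹).1 p) := by
    rw [← minkB_map_mul, mul_inv_cancel_left]
  rw [h5]
  refine h2 (x := ((ρ (k⁻¹ * g)).1 p, (ρ k⁻¹).1 p)) (max_lt (h4 _ ?_) (h4 _ ?_))
  · rw [Oplus.mul_apply, Oplus.fst_map, inv_inv, minkB_comm, hz2]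
  · rw [Oplus.fst_inv_origin, hz1]

end displacement

lemma continuous_ptTop_apply (v : ℝ × H) :
    @Continuous _ _ (ptTop H) _ fun g : Oplus H => g.1 v :=
  @Continuous.comp _ _ _ (ptTop H) _ _ _ _ (continuous_apply v) continuous_induced_dom

lemma continuous_ptTop_mul_right (h : Oplus H) :
    @Continuous _ _ (ptTop H) (ptTop H) fun g : Oplus H => g * h :=
  continuous_induced_rng.2 <| @continuous_pi _ _ _ (ptTop H) _ _ fun v =>
    continuous_ptTop_apply (h.1 v)

lemma continuous_map_apply_of_displacement {ρ : Oplus H →* Oplus H} {p : ℝ × H}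
    (hρ : ∀ η > 0, ∃ c > 1, ∀ g : Oplus H, (g.1 hypOrigin).1 < c → ‖(ρ g).1 p - p‖ < η) :
    @Continuous _ _ (ptTop H) _ fun g : Oplus H => (ρ g).1 p := by
  let := ptTop H
  refine continuous_iff_continuousAt.2 fun g₀ => ?_
  have h1 : Filter.Tendsto (fun g => (ρ (g₀⁻¹ * g)).1 p) (nhds g₀) (nhds p) := by
    refine Metric.tendsto_nhds.2 fun η hη => ?_
    obtain ⟨c, hc, hcg⟩ := hρ η hη
    have h2 : Continuous fun g : Oplus H => minkB H (g.1 hypOrigin) (g₀.1 hypOrigin) :=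
      continuous_minkB.comp ((continuous_ptTop_apply hypOrigin).prodMk continuous_const)
    have h3 : minkB H (g₀.1 hypOrigin) (g₀.1 hypOrigin) < c := by
      rwa [Oplus.minkB_map, hypOrigin_mem.1]
    filter_upwards [h2.continuousAt.eventually_lt_const h3] with g hg
    rw [dist_eq_norm]
    refine hcg _ ?_
    rwa [Oplus.mul_apply, Oplus.fst_map, inv_inv]
  have h4 := ((ρ g₀).1.continuous.tendsto p).comp h1
  refine h4.congr fun g => ?_
  rw [Function.comp_apply, ← Oplus.mul_apply, ← map_mul, mul_inv_cancel_left]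

/-- The vectors on which a representation acts continuously. -/
def continuityVectors (ρ : Oplus H →* Oplus H) : Submodule ℝ (ℝ × H) where
  carrier := {v | @Continuous _ _ (ptTop H) _ fun g : Oplus H => (ρ g).1 v}
  add_mem' {v w} hv hw := by
    let := ptTop H
    simp only [Set.mem_ofPred_eq, map_add]
    exact Continuous.add hv hw
  zero_mem' := by
    let := ptTop H
    simp only [Set.mem_ofPred_eq, map_zero]
    exact continuous_const
  smul_mem' c v hv := by
    let := ptTop H
    simp only [Set.mem_ofPred_eq, map_smul]
    exact Continuous.const_smul hv c

lemma mem_continuityVectors {ρ : Oplus H →* Oplus H} {v : ℝ × H} :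
    v ∈ continuityVectors ρ ↔ @Continuous _ _ (ptTop H) _ fun g : Oplus H => (ρ g).1 v :=
  Iff.rfl

lemma map_mem_continuityVectors {ρ : Oplus H →* Oplus H} {v : ℝ × H}
    (hv : v ∈ continuityVectors ρ) (h : Oplus H) : (ρ h).1 v ∈ continuityVectors ρ := by
  rw [mem_continuityVectors] at hv ⊢
  let := ptTop H
  refine (hv.comp (continuous_ptTop_mul_right h)).congr fun g => ?_
  rw [Function.comp_apply, map_mul, Oplus.mul_apply]

lemma isClosed_continuityVectors {ρ : Oplus H →* Oplus H} {p : ℝ × H} (hp : ‖p.2‖ < p.1)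
    (hpc : p ∈ continuityVectors ρ) : IsClosed (continuityVectors ρ : Set (ℝ × H)) := by
  rw [mem_continuityVectors] at hpc
  let := ptTop H
  refine isClosed_of_closure_subset fun v hv => ?_
  refine continuous_of_locally_uniform_approx_of_continuousAt fun g₀ U hU => ?_
  obtain ⟨ε, hε, hεU⟩ := Metric.mem_uniformity_dist.1 hU
  have hδ := sub_pos.2 hp
  set R := 4 * (((ρ g₀).1 p).1 + 1) / (p.1 - ‖p.2‖)
  have hR : 0 < R := by
    have := Oplus.fst_map_nonneg (ρ g₀) hp.le
    positivity
  obtain ⟨w, hw, hvw⟩ := Metric.mem_closure_iff.1 hv (ε / R) (by positivity)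
  refine ⟨{g | ((ρ g).1 p).1 < ((ρ g₀).1 p).1 + 1},
    (hpc.fst.continuousAt).eventually_lt_const (lt_add_one _), fun g => (ρ g).1 w,
    Continuous.continuousAt hw, fun g hg => hεU ?_⟩
  rw [dist_eq_norm, ← map_sub]
  rw [dist_eq_norm] at hvw
  calc ‖(ρ g).1 (v - w)‖ ≤ 4 * ((ρ g).1 hypOrigin).1 * ‖v - w‖ := Oplus.norm_map_le _ _
    _ ≤ R * ‖v - w‖ := by
      gcongr
      have h1 := Oplus.fst_map_origin_le (ρ g) hp
      have h2 : ((ρ g).1 p).1 / (p.1 - ‖p.2‖) ≤ (((ρ g₀).1 p).1 + 1) / (p.1 - ‖p.2‖) := by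
        gcongr
        exact le_of_lt hg
      simp only [R]
      rw [mul_div_assoc]
      linarith
    _ < R * (ε / R) := by gcongr
    _ = ε := by field_simp

end continuity

/-- automatic continuity: every irreducible self-representation of
`O₊(B)` is continuous for the topology of pointwise convergence. -/
theorem automatic_continuity
    (H : Type*) [NormedAddCommGroup H] [InnerProductSpace ℝ H] [CompleteSpace H]
    [TopologicalSpace.SeparableSpace H] (hinf : ¬ FiniteDimensional ℝ H)
    (ρ : Oplus H →* Oplus H)
    (hirr : ∀ N : Submodule ℝ (ℝ × H), IsClosed (N : Set (ℝ × H)) →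
      (∀ g : Oplus H, ∀ v ∈ N, (ρ g).1 v ∈ N) → N = ⊥ ∨ N = ⊤) :
    @Continuous _ _ (ptTop H) (ptTop H) ρ := by
  obtain ⟨p, hpS, hfix⟩ := exists_fixed_by_stabilizer hinf ρ
  have hp := norm_snd_lt_of_mem_solidHyp hpS
  have hpc : p ∈ continuityVectors ρ := continuous_map_apply_of_displacement fun η hη =>
    exists_forall_norm_map_sub_lt hinf hp hfix hη
  have htop : continuityVectors ρ = ⊤ :=
    (hirr _ (isClosed_continuityVectors hp hpc) fun g _ hv =>
      map_mem_continuityVectors hv g).resolve_left fun hbot => by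
        rw [hbot, Submodule.mem_bot] at hpc
        simp [hpc] at hp
  refine continuous_induced_rng.2 (@continuous_pi _ _ _ (ptTop H) _ _ fun v => ?_)
  have hv : v ∈ continuityVectors ρ := htop ▸ Submodule.mem_top
  exact hv
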